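/- arXiv:2403.08595 — 7 statements merged into one kernel-verified Lean document; each statement's English description precedes it below -/
import Mathlib

section
/- Let D be a division ring with prime subfield ℙ and center F. Then D is weakly locally finite (i.e., for every finite subset S of D, the sub-division-ring of D generated by S is a finite-dimensional vector space over its own center) if and only if for every subfield K of D contained in F and every finite subset S of D, the sub-division-ring of D generated by K ∪ S is a finite-dimensional vector space over its own center. -/
/-- A finite-dimensional subalgebra of a division algebra over a field is closed under inverses. -/
theorem Subalgebra.inv_mem_of_finite {A L : Type*} [Field A] [DivisionRing L] [Algebra A L]
    (V : Subalgebra A L) [Module.Finite A V] {x : L} (hx : x ∈ V) : x⁻¹ ∈ V := by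
  rcases eq_or_ne x 0 with rfl | hx0
  · simp
  have hinj : Function.Injective (LinearMap.mulLeft A (⟨x, hx⟩ : V)) := by
    intro a b hab
    apply Subtype.ext
    exact mul_left_cancel₀ hx0 (congrArg Subtype.val hab)
  obtain ⟨y, hy⟩ := LinearMap.injective_iff_surjective.mp hinj 1
  have hxy : x * (y : L) = 1 := congrArg Subtype.val hy
  rw [inv_eq_of_mul_eq_one_right hxy]
  exact y.2

/-- If a centrally finite division ring `E` maps to a division ring `L`, sending center to center,
and `L` is generated by its center together with the image of `E`, then `L` is centrally finite. -/
theorem Module.Finite.center_of_ringHom {E L : Type*} [DivisionRing E] [DivisionRing L]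
    (f : E →+* L) (hE : Module.Finite (Subring.center E) E)
    (hf : ∀ z ∈ Subring.center E, f z ∈ Subring.center L)
    (hL : Subfield.closure ((Subring.center L : Set L) ∪ Set.range f) = ⊤) :
    Module.Finite (Subring.center L) L := by
  obtain ⟨b, hb⟩ := hE.fg_top
  have hspan : ∀ e : E, f e ∈ Submodule.span (Subring.center L) (f '' (b : Set E)) := by
    intro e
    have he : e ∈ Submodule.span (Subring.center E) (b : Set E) := hb ▸ Submodule.mem_top
    induction he using Submodule.span_induction with
    | mem x hx => exact Submodule.subset_span ⟨x, hx, rfl⟩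
    | zero => simp
    | add x y _ _ hx hy => simpa using add_mem hx hy
    | smul a x _ hx =>
      have h : f (a • x) = (⟨f a, hf a a.2⟩ : Subring.center L) • f x := map_mul f (a : E) x
      rw [h]
      exact Submodule.smul_mem _ _ hx
  let V : Subalgebra (Subring.center L) L := Algebra.adjoin (Subring.center L) (Set.range f)
  have hV : Subalgebra.toSubmodule V =
      Submodule.span (Subring.center L) (f '' (b : Set E)) := by
    have hcl : (Submonoid.closure (Set.range f) : Set L) = Set.range f := by
      simpa only [MonoidHom.coe_mrange, MonoidHom.coe_coe] using congrArg SetLike.coe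
        (Submonoid.closure_eq (MonoidHom.mrange (f : E →* L)))
    rw [Algebra.adjoin_eq_span, hcl]
    apply le_antisymm
    · rw [Submodule.span_le]
      rintro _ ⟨e, rfl⟩
      exact hspan e
    · exact Submodule.span_mono (Set.image_subset_range _ _)
  have hfin : Module.Finite (Subring.center L) V := by
    refine (Module.Finite.iff_fg (N := Subalgebra.toSubmodule V)).mpr ?_
    rw [hV]
    exact Submodule.fg_span (b.finite_toSet.image f)
  let M : Subfield L := V.toSubring.toSubfield fun _ hx => V.inv_mem_of_finite hx
  have hM : (⊤ : Subfield L) ≤ M := by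
    rw [← hL, Subfield.closure_le]
    rintro x (hx | hx)
    · exact V.algebraMap_mem ⟨x, hx⟩
    · exact Algebra.subset_adjoin hx
  refine ⟨?_⟩
  have htop : (⊤ : Submodule (Subring.center L) L) = Subalgebra.toSubmodule V :=
    le_antisymm (fun x _ => hM (Subfield.mem_top x)) le_top
  rw [htop, hV]
  exact Submodule.fg_span (b.finite_toSet.image f)

/-- An element commuting with a set commutes with the division subring generated by it. -/
theorem Subfield.commute_of_mem_closure {D : Type*} [DivisionRing D] {T : Set D} {z : D}
    (hz : ∀ t ∈ T, Commute t z) {x : D} (hx : x ∈ Subfield.closure T) : Commute x z := by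
  induction hx using Subfield.closure_induction with
  | mem x hx => exact hz x hx
  | one => exact Commute.one_left z
  | add x y _ _ hx hy => exact hx.add_left hy
  | neg x _ hx => exact hx.neg_left
  | inv x _ hx => exact hx.inv_left₀
  | mul x y _ _ hx hy => exact hx.mul_left hy

/-- If `L` is generated by a centrally finite division subring `E` together with elements that are
central in `L`, then `L` is centrally finite. -/
theorem Subfield.finite_center_of_eq_closure_union {D : Type*} [DivisionRing D]
    {E L : Subfield D} {T : Set D} (hE : Module.Finite (Subring.center E) E)
    (hL : L = Subfield.closure (T ∪ (E : Set D))) (hT : ∀ t ∈ T, ∀ x ∈ L, Commute x t) :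
    Module.Finite (Subring.center L) L := by
  have hle : E ≤ L := fun x hx => hL ▸ Subfield.subset_closure (Or.inr hx)
  have hTL : T ⊆ L := fun x hx => hL ▸ Subfield.subset_closure (Or.inl hx)
  refine Module.Finite.center_of_ringHom (Subfield.inclusion hle) hE ?_ ?_
  · intro z hz
    rw [Subring.mem_center_iff] at hz ⊢
    rintro ⟨x, hx⟩
    have hcomm : Commute x (z : D) := by
      rw [hL] at hx
      refine Subfield.commute_of_mem_closure ?_ hx
      rintro t (ht | ht)
      · exact (hT t ht z (hle z.2)).symm
      · exact congrArg Subtype.val (hz ⟨t, ht⟩)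
    exact Subtype.ext hcomm.eq
  · have hmap : L ≤ (Subfield.closure ((Subring.center L : Set L) ∪
        Set.range (Subfield.inclusion hle))).map L.subtype := by
      conv_lhs => rw [hL]
      rw [Subfield.closure_le]
      rintro x (hx | hx)
      · refine ⟨⟨x, hTL hx⟩, Subfield.subset_closure (Or.inl ?_), rfl⟩
        exact Subring.mem_center_iff.mpr fun y => Subtype.ext (hT x hx y y.2).eq
      · exact ⟨⟨x, hle hx⟩, Subfield.subset_closure (Or.inr ⟨⟨x, hx⟩, rfl⟩), rfl⟩
    rw [eq_top_iff]
    rintro ⟨x, hx⟩ -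
    obtain ⟨y, hy, hyx⟩ := hmap hx
    have hy' : y = ⟨x, hx⟩ := Subtype.ext hyx
    exact hy' ▸ hy

/-- The prime subfield of a division ring is contained in its center. -/
theorem Subfield.coe_bot_subset_center (D : Type*) [DivisionRing D] :
    ((⊥ : Subfield D) : Set D) ⊆ (Subring.center D : Set D) := by
  intro x hx
  have hx' : x ∈ Subfield.closure (∅ : Set D) := by rwa [Subfield.closure_empty]
  exact Subring.mem_center_iff.mpr fun g =>
    (Subfield.commute_of_mem_closure (z := g) (by simp) hx').eq.symm


/-- A division ring `D` is weakly locally finite (every finite subset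
generates a sub-division-ring that is finite-dimensional over its own center) iff
for every subfield `K` of `D` contained in the center `F` and every finite subset
`S` of `D`, the sub-division-ring generated by `K ∪ S` is finite-dimensional over
its own center. -/
theorem weakly_locally_finite_iff (D : Type*) [DivisionRing D] :
    (∀ S : Finset D,
        Module.Finite (Subring.center (Subfield.closure (S : Set D)))
          (Subfield.closure (S : Set D))) ↔
    (∀ K : Subfield D, (K : Set D) ⊆ (Subring.center D : Set D) → ∀ S : Finset D,
        Module.Finite (Subring.center (Subfield.closure ((K : Set D) ∪ (S : Set D))))
          (Subfield.closure ((K : Set D) ∪ (S : Set D)))) := by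
  constructor
  · intro h K hK S
    refine Subfield.finite_center_of_eq_closure_union (T := (K : Set D)) (h S) ?_ ?_
    · rw [Subfield.closure_union, Subfield.closure_union, Subfield.closure_eq (Subfield.closure _)]
    · intro t ht x _
      exact Subring.mem_center_iff.mp (hK ht) x
  · intro h S
    have heq : Subfield.closure (((⊥ : Subfield D) : Set D) ∪ (S : Set D)) =
        Subfield.closure (S : Set D) := by
      rw [Subfield.closure_union, Subfield.closure_eq, bot_sup_eq]
    exact heq ▸ h ⊥ (Subfield.coe_bot_subset_center D) S
end

section
/- Let A be a finite-dimensional central simple algebra over a field F with dim_F A = m², and let ⋆ be an involution of the first kind on A. If d is the dimension over F of the F-subspace T_A = {x + x^⋆ : x ∈ A} of A, then d = m(m+1)/2 or d = m(m−1)/2. -/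
open scoped TensorProduct Matrix

/-- For a finite-dimensional central simple algebra, every linear endomorphism is a sum of
maps `x ↦ a * x * b`. -/
theorem mulLeftRight_surjective_of_central_simple (F A : Type*) [Field F] [Ring A] [Algebra F A]
    [IsSimpleRing A] [FiniteDimensional F A] (hcentral : Subalgebra.center F A = ⊥) :
    Function.Surjective (AlgHom.mulLeftRight F A) := by
  let R : Subalgebra F (Module.End F A) := (AlgHom.mulLeftRight F A).range
  have hR (a b : A) : ∃ r : R, ∀ x : A, r • x = a * x * b :=
    ⟨⟨_, a ⊗ₜ MulOpposite.op b, rfl⟩, fun x ↦ by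
      rw [Subalgebra.smul_def]
      exact AlgHom.mulLeftRight_apply F A a (MulOpposite.op b) x⟩
  have : IsSimpleModule R A := by
    rw [isSimpleModule_iff]
    refine { exists_pair_ne := exists_pair_ne _, eq_bot_or_eq_top := fun N ↦ ?_ }
    refine or_iff_not_imp_left.2 fun hN ↦ ?_
    obtain ⟨x, hx, hx0⟩ := N.exists_mem_ne_zero_of_ne_bot hN
    let I : TwoSidedIdeal A := .mk' N N.zero_mem N.add_mem
      (fun {y} hy ↦ by
        obtain ⟨r, hr⟩ := hR (-1) 1
        simpa [hr] using N.smul_mem r hy)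
      (fun {a y} hy ↦ by
        obtain ⟨r, hr⟩ := hR a 1
        simpa [hr] using N.smul_mem r hy)
      (fun {y b} hy ↦ by
        obtain ⟨r, hr⟩ := hR 1 b
        simpa [hr] using N.smul_mem r hy)
    have hI (y : A) : y ∈ I ↔ y ∈ N := TwoSidedIdeal.mem_mk' ..
    have h1 : (1 : A) ∈ N :=
      (hI 1).1 (IsSimpleRing.one_mem_of_ne_zero_mem I hx0 ((hI x).2 hx))
    refine eq_top_iff.2 fun y _ ↦ ?_
    obtain ⟨r, hr⟩ := hR y 1
    simpa [hr] using N.smul_mem r h1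
  classical
  intro f
  have hf (φ : Module.End R A) (x : A) : f (φ x) = φ (f x) := by
    have hl (x : A) : φ x = x * φ 1 := by
      obtain ⟨r, hr⟩ := hR x 1
      simpa [hr] using φ.map_smul r 1
    have hr (x : A) : φ x = φ 1 * x := by
      obtain ⟨r, hr⟩ := hR 1 x
      simpa [hr] using φ.map_smul r 1
    have hc : φ 1 ∈ Subalgebra.center F A :=
      Subalgebra.mem_center_iff.2 fun x ↦ by rw [← hl, hr]
    rw [hcentral, Algebra.mem_bot] at hc
    obtain ⟨c, hc⟩ := hc
    simp only [hr x, hr (f x), ← hc, ← Algebra.smul_def, map_smul]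
  let g : Module.End (Module.End R A) A :=
    { toFun := f, map_add' := f.map_add, map_smul' := hf }
  let b := Module.finBasis F A
  obtain ⟨⟨_, s, rfl⟩, hr⟩ := jacobson_density (R := R) g (Finset.univ.image b)
  refine ⟨s, b.ext fun i ↦ ?_⟩
  exact (hr (b i) (by simp)).symm

/-- A scalar extension of a finite-dimensional central simple algebra is simple. -/
theorem isSimpleRing_tensorProduct_of_central_simple (F A K : Type*) [Field F] [Ring A]
    [Algebra F A] [IsSimpleRing A] [FiniteDimensional F A] [Field K] [Algebra F K]
    (hcentral : Subalgebra.center F A = ⊥) : IsSimpleRing (K ⊗[F] A) := by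
  have : Nontrivial (K ⊗[F] A) :=
    (Algebra.TensorProduct.includeLeft_injective (S := F) (A := K) (B := A)
      (algebraMap F A).injective).nontrivial
  refine ⟨⟨fun I ↦ or_iff_not_imp_left.2 fun hI ↦ ?_⟩⟩
  have hend (f : Module.End F A) (x : K ⊗[F] A) (hx : x ∈ I) : f.baseChange K x ∈ I := by
    obtain ⟨s, rfl⟩ := mulLeftRight_surjective_of_central_simple F A hcentral f
    induction s with
    | zero => simp
    | add s t hs ht => simpa using I.add_mem hs ht
    | tmul a b =>
      have : (AlgHom.mulLeftRight F A (a ⊗ₜ b)).baseChange K x =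
          (1 ⊗ₜ a) * x * (1 ⊗ₜ b.unop) := by
        clear hx
        induction x with
        | zero => simp
        | add x y hx hy => simp only [map_add, hx, hy, mul_add, add_mul]
        | tmul k y => simp
      rw [this]
      exact I.mul_mem_right _ _ (I.mul_mem_left _ _ hx)
  obtain ⟨x, hx, hx0⟩ : ∃ x ∈ I, x ≠ 0 := by
    by_contra! h
    exact hI (eq_bot_iff.2 fun x hx ↦ (TwoSidedIdeal.mem_bot _).2 (h x hx))
  let b := Module.finBasis F A
  obtain ⟨i, hi⟩ : ∃ i, (b.baseChange K).repr x i ≠ 0 := by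
    by_contra! h
    exact hx0 ((b.baseChange K).repr.map_eq_zero_iff.1 (Finsupp.ext h))
  have key (y : K ⊗[F] A) : ((b.coord i).smulRight (1 : A)).baseChange K y =
      (b.baseChange K).repr y i ⊗ₜ 1 := by
    induction y with
    | zero => simp
    | add y z hy hz => simp only [map_add, hy, hz, Finsupp.add_apply, TensorProduct.add_tmul]
    | tmul k y => simp [TensorProduct.smul_tmul]
  have h := I.mul_mem_left (((b.baseChange K).repr x i)⁻¹ ⊗ₜ 1) _ (key x ▸ hend _ x hx)
  rw [Algebra.TensorProduct.tmul_mul_tmul, inv_mul_cancel₀ hi, one_mul,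
    ← Algebra.TensorProduct.one_def] at h
  exact eq_top_iff.2 fun y _ ↦ by simpa using I.mul_mem_left y _ h

theorem finrank_range_baseChange {F K V W : Type*} [Field F] [Field K] [Algebra F K]
    [AddCommGroup V] [Module F V] [AddCommGroup W] [Module F W] (f : V →ₗ[F] W) :
    Module.finrank K (f.baseChange K).range = Module.finrank F f.range := by
  have h : (f.baseChange K).range = f.range.baseChange K := by
    have : f.baseChange K = f.range.subtype.baseChange K ∘ₗ f.rangeRestrict.baseChange K := by
      rw [← LinearMap.baseChange_comp]; rfl
    rw [this, LinearMap.range_comp_of_range_eq_top]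
    · rfl
    · exact LinearMap.range_eq_top.2
        (LinearMap.lTensor_surjective K f.surjective_rangeRestrict)
  rw [h, ← (Submodule.toBaseChange.toLinearEquiv K f.range).finrank_eq,
    Module.finrank_baseChange]

/-- The symmetric matrices form a space of dimension `n(n+1)/2`. -/
theorem finrank_ker_id_sub_transpose (K : Type*) [Field K] (n : ℕ) :
    Module.finrank K (LinearMap.ker (LinearMap.id -
      (Matrix.transposeLinearEquiv (Fin n) (Fin n) K K).toLinearMap)) = n * (n + 1) / 2 := by
  let g : (Sym2 (Fin n) → K) →ₗ[K] Matrix (Fin n) (Fin n) K :=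
    { toFun := fun f ↦ .of fun i j ↦ f s(i, j)
      map_add' := fun _ _ ↦ rfl
      map_smul' := fun _ _ ↦ rfl }
  have hg : Function.Injective g := fun f f' h ↦ by
    ext z
    induction z with
    | _ i j => exact congrFun (congrFun h i) j
  have hr : LinearMap.ker (LinearMap.id -
      (Matrix.transposeLinearEquiv (Fin n) (Fin n) K K).toLinearMap) = g.range := by
    ext X
    simp only [LinearMap.mem_ker, LinearMap.sub_apply, LinearMap.id_apply, LinearEquiv.coe_coe,
      Matrix.transposeLinearEquiv_apply, sub_eq_zero, LinearMap.mem_range]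
    refine ⟨fun h ↦ ⟨Sym2.lift ⟨X, fun i j ↦ congrFun (congrFun h i) j⟩, rfl⟩, ?_⟩
    rintro ⟨f, rfl⟩
    ext i j
    exact congrArg f Sym2.eq_swap
  rw [hr, LinearMap.finrank_range_of_inj hg, Module.finrank_fintype_fun_eq_card, Sym2.card,
    Fintype.card_fin, Nat.choose_two_right, Nat.add_sub_cancel, mul_comm]

theorem finrank_range_id_sub_transpose (K : Type*) [Field K] (n : ℕ) :
    Module.finrank K (LinearMap.range (LinearMap.id -
      (Matrix.transposeLinearEquiv (Fin n) (Fin n) K K).toLinearMap)) = n * (n - 1) / 2 := by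
  have h := LinearMap.finrank_range_add_finrank_ker (LinearMap.id -
      (Matrix.transposeLinearEquiv (Fin n) (Fin n) K K).toLinearMap)
  rw [finrank_ker_id_sub_transpose, Module.finrank_matrix, Fintype.card_fin,
    Module.finrank_self, mul_one] at h
  have h1 := Nat.div_mul_cancel (Nat.even_mul_succ_self n).two_dvd
  have h2 := Nat.div_mul_cancel (Nat.even_mul_pred_self n).two_dvd
  have h3 : n * (n + 1) + n * (n - 1) = 2 * (n * n) := by
    rcases n with _ | n
    · rfl
    · simp only [Nat.add_sub_cancel]; ring
  omega

theorem finrank_range_id_add_transpose (K : Type*) [Field K] (h2 : (2 : K) ≠ 0) (n : ℕ) :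
    Module.finrank K (LinearMap.range (LinearMap.id +
      (Matrix.transposeLinearEquiv (Fin n) (Fin n) K K).toLinearMap)) = n * (n + 1) / 2 := by
  rw [← finrank_ker_id_sub_transpose K n]
  suffices LinearMap.range (LinearMap.id +
      (Matrix.transposeLinearEquiv (Fin n) (Fin n) K K).toLinearMap) =
      LinearMap.ker (LinearMap.id -
        (Matrix.transposeLinearEquiv (Fin n) (Fin n) K K).toLinearMap) by rw [this]
  ext X
  simp only [LinearMap.mem_ker, LinearMap.sub_apply, LinearMap.id_apply, LinearEquiv.coe_coe,
    LinearMap.add_apply, Matrix.transposeLinearEquiv_apply, sub_eq_zero, LinearMap.mem_range]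
  constructor
  · rintro ⟨Y, rfl⟩
    change Y + Yᵀ = (Y + Yᵀ)ᵀ
    rw [Matrix.transpose_add, Matrix.transpose_transpose, add_comm]
  · intro (h : X = Xᵀ)
    refine ⟨(2 : K)⁻¹ • X, ?_⟩
    change (2 : K)⁻¹ • X + ((2 : K)⁻¹ • X)ᵀ = X
    rw [Matrix.transpose_smul, ← h, ← smul_add, ← two_smul K X, inv_smul_smul₀ h2]

theorem exists_eq_mul_transpose_mul (K : Type*) [Field K] (n : ℕ)
    (ρ : Matrix (Fin n) (Fin n) K →ₗ[K] Matrix (Fin n) (Fin n) K)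
    (hmul : ∀ X Y, ρ (X * Y) = ρ Y * ρ X) (hinvo : ∀ X, ρ (ρ X) = X) :
    ∃ U V : Matrix (Fin n) (Fin n) K, U * V = 1 ∧ V * U = 1 ∧ ∀ X, ρ X = U * Xᵀ * V := by
  have h1 : ρ 1 = 1 := by
    have := hmul (ρ 1) 1
    rw [mul_one, hinvo, mul_one] at this
    exact this.symm
  let f : Matrix (Fin n) (Fin n) K →ₐ[K] Matrix (Fin n) (Fin n) K :=
    AlgHom.ofLinearMap (ρ ∘ₗ (Matrix.transposeLinearEquiv (Fin n) (Fin n) K K).toLinearMap)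
      (by simp [h1]) (fun X Y ↦ by simp [hmul])
  have hf (X) : f X = ρ Xᵀ := rfl
  let e : Matrix (Fin n) (Fin n) K ≃ₐ[K] Matrix (Fin n) (Fin n) K :=
    .ofBijective f ⟨fun X Y h ↦ by
      rw [hf, hf] at h
      simpa [hinvo] using congrArg ρ h, fun X ↦ ⟨(ρ X)ᵀ, by simp [hf, hinvo]⟩⟩
  let L := Matrix.toLinAlgEquiv' (R := K) (n := Fin n)
  obtain ⟨T, hT⟩ := ((L.symm.trans e).trans L).eq_linearEquivConjAlgEquiv
  refine ⟨L.symm T, L.symm T.symm, ?_, ?_, fun X ↦ L.injective ?_⟩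
  · rw [← map_mul, Module.End.mul_eq_comp, LinearEquiv.comp_symm, ← Module.End.one_eq_id, map_one]
  · rw [← map_mul, Module.End.mul_eq_comp, LinearEquiv.symm_comp, ← Module.End.one_eq_id, map_one]
  · have := congrArg (fun g ↦ g (L Xᵀ)) hT
    rw [map_mul, map_mul, L.apply_symm_apply, L.apply_symm_apply]
    calc L (ρ X) = L (e (L.symm (L Xᵀ))) := by
          rw [L.symm_apply_apply, ← Matrix.transpose_transpose X, ← hf,
            Matrix.transpose_transpose]
          rfl
      _ = T.conjAlgEquiv K (L Xᵀ) := this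

theorem finrank_range_id_add_matrix_involution (K : Type*) [Field K] (n : ℕ) [NeZero n]
    (ρ : Matrix (Fin n) (Fin n) K →ₗ[K] Matrix (Fin n) (Fin n) K)
    (hmul : ∀ X Y, ρ (X * Y) = ρ Y * ρ X) (hinvo : ∀ X, ρ (ρ X) = X) :
    Module.finrank K (LinearMap.range (LinearMap.id + ρ)) = n * (n + 1) / 2 ∨
      Module.finrank K (LinearMap.range (LinearMap.id + ρ)) = n * (n - 1) / 2 := by
  obtain ⟨U, V, hUV, hVU, hρ⟩ := exists_eq_mul_transpose_mul K n ρ hmul hinvo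
  have hUVt : Uᵀ * Vᵀ = 1 := by rw [← Matrix.transpose_mul, hVU, Matrix.transpose_one]
  have hVUt : Vᵀ * Uᵀ = 1 := by rw [← Matrix.transpose_mul, hUV, Matrix.transpose_one]
  have hU (X) : U * (Vᵀ * X * Uᵀ) * V = X := by
    simpa [hρ, mul_assoc] using hinvo X
  have hcomm (X) : X * (U * Vᵀ) = (U * Vᵀ) * X := by
    calc X * (U * Vᵀ) = (U * (Vᵀ * X * Uᵀ) * V) * (U * Vᵀ) := by rw [hU]
      _ = U * Vᵀ * X * (Uᵀ * ((V * U) * Vᵀ)) := by simp only [mul_assoc]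
      _ = U * Vᵀ * X := by rw [hVU, one_mul, hUVt, mul_one]
  obtain ⟨ε, hε⟩ := Matrix.mem_range_scalar_iff_commute_single'.2
    (fun i j ↦ hcomm (Matrix.single i j 1))
  have hUε : U = ε • Uᵀ := by
    calc U = U * Vᵀ * Uᵀ := by rw [mul_assoc, hVUt, mul_one]
      _ = ε • Uᵀ := by rw [← hε, Matrix.scalar_apply, ← Matrix.smul_eq_diagonal_mul]
  have hε2 : ε * ε = 1 := by
    have hU0 : U ≠ 0 := by
      rintro rfl
      simp at hUV
    have h : (ε * ε) • U = (1 : K) • U := by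
      have ht : Uᵀ = ε • U := by
        simpa using congrArg Matrix.transpose hUε
      rw [one_smul, mul_smul, ← ht, ← hUε]
    exact smul_left_injective K hU0 h
  let R : Matrix (Fin n) (Fin n) K ≃ₗ[K] Matrix (Fin n) (Fin n) K :=
    { LinearMap.mulRight K U with
      invFun := fun X ↦ X * V
      left_inv := fun X ↦ by simp [mul_assoc, hUV]
      right_inv := fun X ↦ by simp [mul_assoc, hVU] }
  have hconj : LinearMap.id + ρ = R.symm.toLinearMap ∘ₗ (LinearMap.id +
      ε • (Matrix.transposeLinearEquiv (Fin n) (Fin n) K K).toLinearMap) ∘ₗ R.toLinearMap := by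
    ext1 X
    change X + ρ X = (X * U + ε • (X * U)ᵀ) * V
    rw [hρ, add_mul, mul_assoc X, hUV, mul_one, Matrix.transpose_mul, ← Matrix.smul_mul, ← hUε]
  have hrank : Module.finrank K (LinearMap.range (LinearMap.id + ρ)) =
      Module.finrank K (LinearMap.range (LinearMap.id +
        ε • (Matrix.transposeLinearEquiv (Fin n) (Fin n) K K).toLinearMap)) := by
    rw [hconj, LinearMap.range_comp, LinearEquiv.range_comp]
    exact LinearEquiv.finrank_map_eq R.symm _
  rw [hrank]
  by_cases hε1 : ε = -1
  · right
    have h : LinearMap.id + ε • (Matrix.transposeLinearEquiv (Fin n) (Fin n) K K).toLinearMap =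
        LinearMap.id - (Matrix.transposeLinearEquiv (Fin n) (Fin n) K K).toLinearMap := by
      ext1 X
      simp [hε1, sub_eq_add_neg]
    rw [h, finrank_range_id_sub_transpose]
  · left
    have hε' : ε = 1 := (mul_self_eq_one_iff.1 hε2).resolve_right hε1
    rw [hε', one_smul, finrank_range_id_add_transpose]
    intro h2
    refine hε1 (hε'.trans ?_)
    linear_combination h2


/-- Let `A` be a finite-dimensional central simple algebra over a field
`F` with `dim_F A = m²`, and `σ` an involution of the first kind on `A`. If `d` is
the dimension over `F` of the subspace `T_A = {x + σ x : x ∈ A}`, then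
`d = m(m+1)/2` or `d = m(m-1)/2`. -/
theorem dim_traces_of_central_simple (F A : Type*) [Field F] [Ring A] [Algebra F A]
    [IsSimpleRing A] [FiniteDimensional F A]
    (hcentral : Subalgebra.center F A = ⊥)
    (m : ℕ) (hm : Module.finrank F A = m ^ 2)
    (σ : A → A)
    (hadd : ∀ x y : A, σ (x + y) = σ x + σ y)
    (hmul : ∀ x y : A, σ (x * y) = σ y * σ x)
    (hinvo : ∀ x : A, σ (σ x) = x)
    (hfirst : ∀ x ∈ Subring.center A, σ x = x)
    (T : Submodule F A) (hT : (T : Set A) = {y : A | ∃ x : A, x + σ x = y})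
    (d : ℕ) (hd : d = Module.finrank F T) :
    d = m * (m + 1) / 2 ∨ d = m * (m - 1) / 2 := by
  have hone : σ 1 = 1 := hfirst 1 (Subring.one_mem _)
  have hscalar (c : F) : σ (algebraMap F A c) = algebraMap F A c :=
    hfirst _ (Subring.mem_center_iff.2 fun x ↦ (Algebra.commutes c x).symm)
  let s : A →ₗ[F] A :=
    { toFun := σ
      map_add' := hadd
      map_smul' := fun c x ↦ by
        rw [Algebra.smul_def, hmul, hscalar, ← Algebra.commutes, ← Algebra.smul_def]
        rfl }
  have hTs : T = LinearMap.range (LinearMap.id + s) := SetLike.coe_injective hT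
  let K := AlgebraicClosure F
  have := isSimpleRing_tensorProduct_of_central_simple F A K hcentral
  obtain ⟨n, _, ⟨e⟩⟩ := IsSimpleRing.exists_algEquiv_matrix_of_isAlgClosed K (K ⊗[F] A)
  have hn : n = m := by
    have h := e.toLinearEquiv.finrank_eq
    rw [Module.finrank_baseChange, hm, Module.finrank_matrix, Fintype.card_fin,
      Module.finrank_self, mul_one, ← sq] at h
    exact (Nat.pow_left_injective two_ne_zero h).symm
  subst hn
  have hsmul (x y : K ⊗[F] A) :
      s.baseChange K (x * y) = s.baseChange K y * s.baseChange K x := by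
    induction x with
    | zero => simp
    | add x x' hx hx' => simp only [add_mul, mul_add, map_add, hx, hx']
    | tmul k a =>
      induction y with
      | zero => simp
      | add y y' hy hy' => simp only [add_mul, mul_add, map_add, hy, hy']
      | tmul l b =>
        simp only [Algebra.TensorProduct.tmul_mul_tmul, LinearMap.baseChange_tmul]
        rw [mul_comm k l]
        exact congrArg _ (hmul a b)
  have hsinvo (x : K ⊗[F] A) : s.baseChange K (s.baseChange K x) = x := by
    induction x with
    | zero => simp
    | add x y hx hy => simp only [map_add, hx, hy]
    | tmul k a =>
      simp only [LinearMap.baseChange_tmul]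
      exact congrArg _ (hinvo a)
  let E := e.toLinearEquiv
  have hrank : d = Module.finrank K
      (LinearMap.range (LinearMap.id + E.conj (s.baseChange K))) := by
    have h : LinearMap.id + E.conj (s.baseChange K) =
        E.toLinearMap ∘ₗ (LinearMap.id + s).baseChange K ∘ₗ E.symm.toLinearMap := by
      ext1 X
      simp [LinearMap.baseChange_add, LinearEquiv.conj_apply]
    rw [hd, hTs, ← finrank_range_baseChange (K := K), h, LinearMap.range_comp,
      LinearEquiv.range_comp]
    exact (LinearEquiv.finrank_map_eq E _).symm
  rw [hrank]
  refine finrank_range_id_add_matrix_involution K n _ (fun X Y ↦ ?_) (fun X ↦ ?_)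
  · simp [E, LinearEquiv.conj_apply, hsmul]
  · simp [E, LinearEquiv.conj_apply, hsinvo]
end

section
/- Let D be a centrally finite division ring with center F, let n be a positive integer, and let ⋆ be an involution of the first kind on M_n(D) such that x + x^⋆ lies in the center of M_n(D) for every x ∈ M_n(D). Then either (i) n = 1 and either D is commutative (D = F) or D is a quaternion division algebra over F (i.e., dim_F D = 4), or (ii) n = 2, D is commutative (D = F), and ⋆ is the ordinary symplectic involution on M_2(F), i.e., M^⋆ = adjugate M for every M. -/
/-- If `σ` reverses products and `x + σ x` is always central, then so is the
norm `x * x - (x + σ x) * x`. -/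
theorem mul_self_sub_trace_mul_mem_center {R : Type*} [Ring R] {σ : R → R}
    (hmul : ∀ x y, σ (x * y) = σ y * σ x)
    (htr : ∀ x, x + σ x ∈ Subring.center R) (x : R) :
    x * x - (x + σ x) * x ∈ Subring.center R := by
  rw [Subring.mem_center_iff]
  intro y
  obtain ⟨c, hc⟩ : ∃ c, c = x + σ x := ⟨_, rfl⟩
  obtain ⟨d, hd⟩ : ∃ d, d = y + σ y := ⟨_, rfl⟩
  have hcc := hc ▸ Subring.mem_center_iff.1 (htr x)
  have hdc := hd ▸ Subring.mem_center_iff.1 (htr y)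
  have h := Subring.mem_center_iff.1 (htr (x * y)) x
  rw [hmul, eq_sub_of_add_eq' hc.symm, eq_sub_of_add_eq' hd.symm] at h
  rw [← hc]
  have h1 : x * (d * c) = d * c * x := by rw [← mul_assoc, hdc, mul_assoc, hcc, mul_assoc]
  have h2 : x * (d * x) = d * x * x := by rw [← mul_assoc, hdc]
  have h3 : x * (y * c) = c * x * y := by rw [hcc y, ← mul_assoc, hcc x]
  have h4 : y * c * x = y * (c * x) := mul_assoc ..
  simp only [mul_add, mul_sub, add_mul, sub_mul] at h ⊢
  rw [h1, h2, h3, h4] at h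
  have h5 : x * x * y - c * x * y - (y * (x * x) - y * (c * x)) = 0 := by
    rw [← sub_eq_zero] at h
    rw [← h]
    noncomm_ring
  exact (sub_eq_zero.1 h5).symm

/-- A noncommutative division ring with a first-kind involution all of whose traces are central
is four-dimensional over its center. -/
theorem DivisionRing.finrank_center_eq_four {D : Type*} [DivisionRing D] {σ : D → D}
    (hadd : ∀ x y, σ (x + y) = σ x + σ y) (hmul : ∀ x y, σ (x * y) = σ y * σ x)
    (hinvo : ∀ x, σ (σ x) = x) (hfirst : ∀ x ∈ Subring.center D, σ x = x)
    (htr : ∀ x, x + σ x ∈ Subring.center D) {u v : D} (huv : u * v ≠ v * u) :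
    Module.finrank (Subring.center D) D = 4 := by
  let B (y : D) : D →ₗ[Subring.center D] Subring.center D :=
    { toFun := fun z => ⟨z * σ y + y * σ z, by
        simpa [hmul, hinvo] using htr (z * σ y)⟩
      map_add' := fun a b => by
        ext
        simp only [hadd, Subring.coe_add]
        noncomm_ring
      map_smul' := fun c z => by
        ext
        have hc := Subring.mem_center_iff.1 c.2
        simp only [Subring.smul_def, smul_eq_mul, hmul, hfirst _ c.2, RingHom.id_apply,
          Subring.coe_mul, mul_add, mul_assoc]
        rw [← mul_assoc y, hc] }
  let L : D →ₗ[Subring.center D] (Fin 4 → Subring.center D) :=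
    LinearMap.pi ![B 1, B u, B v, B (u * v)]
  have hL : Function.Injective L := by
    rw [injective_iff_map_eq_zero]
    intro z hz
    have key (i : Fin 4) := congrFun hz i
    have h1 : z * σ 1 + 1 * σ z = 0 := congrArg Subtype.val (key 0)
    have hu : z * σ u + u * σ z = 0 := congrArg Subtype.val (key 1)
    have hv : z * σ v + v * σ z = 0 := congrArg Subtype.val (key 2)
    have hw : z * σ (u * v) + u * v * σ z = 0 := congrArg Subtype.val (key 3)
    have hz1 : σ z = -z := by
      rw [hfirst 1 (one_mem _), mul_one, one_mul] at h1
      exact eq_neg_of_add_eq_zero_right h1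
    simp only [hz1, mul_neg, ← sub_eq_add_neg, sub_eq_zero] at hu hv hw
    by_contra hne
    have h : z * σ (u * v) = z * σ (v * u) := by
      rw [hw, hmul v u, ← mul_assoc z, hu, mul_assoc u z, hv, mul_assoc]
    have h' := congrArg σ (mul_left_cancel₀ hne h)
    rw [hinvo, hinvo] at h'
    exact huv h'
  have : Module.Finite (Subring.center D) D := Module.Finite.of_injective L hL
  refine le_antisymm ?_ ?_
  · simpa using LinearMap.finrank_le_finrank_of_injective hL
  have hu (a b : D) (ha : a ∈ Subring.center D) (hb : b ∈ Subring.center D)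
      (h : a + b * u = 0) : a = 0 ∧ b = 0 := by
    have hb0 : b = 0 := by
      by_contra hb0
      have hux : u ∈ Subring.center D := by
        rw [← inv_mul_cancel_left₀ hb0 u, eq_neg_of_add_eq_zero_right h]
        exact mul_mem (Set.inv_mem_center hb) (neg_mem ha)
      exact huv (Subring.mem_center_iff.1 hux v).symm
    exact ⟨by simpa [hb0] using h, hb0⟩
  have hcomm (a b : D) (ha : a ∈ Subring.center D) (hb : b ∈ Subring.center D) :
      Commute u (a + b * u) :=
    .add_right (Subring.mem_center_iff.1 ha u)
      (.mul_right (Subring.mem_center_iff.1 hb u) (.refl u))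
  have hli : LinearIndependent (Subring.center D) ![1, u, v, u * v] := by
    rw [Fintype.linearIndependent_iff]
    intro g hg
    simp only [Fin.sum_univ_four, Subring.smul_def, smul_eq_mul, Matrix.cons_val, mul_one] at hg
    have hg' : (g 0 + g 1 * u : D) + (g 2 + g 3 * u) * v = 0 := by
      rw [← hg]
      noncomm_ring
    have h23 : (g 2 + g 3 * u : D) = 0 := by
      by_contra hne
      refine huv ?_
      have hv : Commute u v := by
        rw [← inv_mul_cancel_left₀ hne v, eq_neg_of_add_eq_zero_right hg']
        exact .mul_right (hcomm _ _ (g 2).2 (g 3).2).inv_right₀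
          (hcomm _ _ (g 0).2 (g 1).2).neg_right
      exact hv
    rw [h23, zero_mul, add_zero] at hg'
    obtain ⟨h2, h3⟩ := hu _ _ (g 2).2 (g 3).2 h23
    obtain ⟨h0, h1⟩ := hu _ _ (g 0).2 (g 1).2 hg'
    intro i
    fin_cases i <;> exact Subtype.ext ‹_›
  simpa using hli.fintype_card_le_finrank

/-- A central matrix is scalar, with central diagonal entry. -/
theorem Matrix.exists_eq_scalar_of_mem_center {m R : Type*} [Fintype m] [DecidableEq m] [Ring R]
    {M : Matrix m m R} (hM : M ∈ Subring.center (Matrix m m R)) :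
    ∃ c ∈ Subring.center R, M = Matrix.scalar m c := by
  rw [Matrix.subringCenter_eq_scalar_map] at hM
  obtain ⟨c, hc, rfl⟩ := hM
  exact ⟨c, hc, rfl⟩


/-- Let `D` be a centrally finite division ring with center `F`, `n` a
positive integer, and `σ` an involution of the first kind on `M_n(D)` with
`x + σ x` central for every `x`. Then either (i) `n = 1` and `D` is commutative or
a quaternion division algebra over `F` (`dim_F D = 4`), or (ii) `n = 2`, `D` is
commutative, and `σ` is the ordinary symplectic involution, i.e. the adjugate map
(for `2 × 2` matrices, `adjugate M = (trace M) • 1 - M`). -/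
theorem centrally_finite_symplectic_classification (D : Type*) [DivisionRing D]
    [Module.Finite (Subring.center D) D]
    (n : ℕ) (hn : 0 < n)
    (σ : Matrix (Fin n) (Fin n) D → Matrix (Fin n) (Fin n) D)
    (hadd : ∀ x y, σ (x + y) = σ x + σ y)
    (hmul : ∀ x y, σ (x * y) = σ y * σ x)
    (hinvo : ∀ x, σ (σ x) = x)
    (hfirst : ∀ x ∈ Subring.center (Matrix (Fin n) (Fin n) D), σ x = x)
    (htr : ∀ x : Matrix (Fin n) (Fin n) D,
      x + σ x ∈ Subring.center (Matrix (Fin n) (Fin n) D)) :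
    (n = 1 ∧ ((∀ a b : D, a * b = b * a) ∨ Module.finrank (Subring.center D) D = 4)) ∨
    (n = 2 ∧ (∀ a b : D, a * b = b * a) ∧
      ∀ M : Matrix (Fin n) (Fin n) D,
        σ M = Matrix.trace M • (1 : Matrix (Fin n) (Fin n) D) - M) := by
  have hquad (x : Matrix (Fin n) (Fin n) D) : ∃ t ∈ Subring.center D, ∃ c ∈ Subring.center D,
      x + σ x = Matrix.scalar _ t ∧ x * x - Matrix.scalar _ t * x = Matrix.scalar _ c := by
    obtain ⟨t, ht, hxt⟩ := Matrix.exists_eq_scalar_of_mem_center (htr x)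
    obtain ⟨c, hc, hxc⟩ := Matrix.exists_eq_scalar_of_mem_center
      (mul_self_sub_trace_mul_mem_center hmul htr x)
    exact ⟨t, ht, c, hc, hxt, hxt ▸ hxc⟩
  obtain rfl | rfl | hn3 : n = 1 ∨ n = 2 ∨ 3 ≤ n := by omega
  · refine .inl ⟨rfl, or_iff_not_imp_left.2 fun hnc => ?_⟩
    push Not at hnc
    obtain ⟨u, v, huv⟩ := hnc
    let e : Matrix (Fin 1) (Fin 1) D ≃+* D := Matrix.uniqueRingEquiv
    have hmem {x : Matrix (Fin 1) (Fin 1) D} (hx : x ∈ Subring.center _) :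
        e x ∈ Subring.center D := Subring.mem_center_iff.2 fun g => by
      simpa using congrArg e (Subring.mem_center_iff.1 hx (e.symm g))
    have hmem' {x : D} (hx : x ∈ Subring.center D) :
        e.symm x ∈ Subring.center (Matrix (Fin 1) (Fin 1) D) :=
      Subring.mem_center_iff.2 fun g => by
        simpa using congrArg e.symm (Subring.mem_center_iff.1 hx (e g))
    exact DivisionRing.finrank_center_eq_four (σ := fun x => e (σ (e.symm x)))
      (by simp [hadd]) (by simp [hmul]) (by simp [hinvo])
      (fun x hx => by simp [hfirst _ (hmem' hx)])
      (fun x => by simpa using hmem (htr (e.symm x))) huv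
  · have hcomm (a b : D) : a * b = b * a := by
      suffices ha : a ∈ Subring.center D from (Subring.mem_center_iff.1 ha b).symm
      obtain ⟨t, ht, c, -, -, h⟩ := hquad !![a, 0; 0, 0]
      have h0 := congr($h 0 0)
      have h1 := congr($h 1 1)
      simp [Matrix.mul_apply, Matrix.diagonal] at h0 h1
      rw [← h1, sub_eq_zero] at h0
      by_cases ha : a = 0
      · exact ha ▸ zero_mem _
      · exact mul_right_cancel₀ ha h0 ▸ ht
    refine .inr ⟨rfl, hcomm, fun M => ?_⟩
    obtain ⟨t, -, c, -, hMt, h⟩ := hquad M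
    suffices htM : t = M.trace by
      rw [eq_sub_of_add_eq' hMt, htM, Matrix.smul_one_eq_diagonal, Matrix.scalar_apply]
    let : Field D := { (inferInstance : DivisionRing D) with mul_comm := hcomm }
    have h00 := congr($h 0 0)
    have h01 := congr($h 0 1)
    have h10 := congr($h 1 0)
    have h11 := congr($h 1 1)
    simp [Matrix.mul_apply, Matrix.diagonal] at h00 h01 h10 h11
    rw [Matrix.trace_fin_two]
    by_cases hM : M 0 1 = 0 ∧ M 1 0 = 0 ∧ M 0 0 = M 1 1
    · have hMc : M ∈ Subring.center (Matrix (Fin 2) (Fin 2) D) := by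
        have hMs : M = Matrix.scalar (Fin 2) (M 1 1) := by
          ext i j
          fin_cases i <;> fin_cases j <;> simp [hM]
        rw [hMs, Subring.mem_center_iff]
        exact fun g => (Matrix.scalar_commute _ (hcomm _) g).symm
      have := congr($hMt 0 0)
      rw [hfirst M hMc] at this
      simpa [hM.2.2] using this.symm
    · simp only [not_and_or] at hM
      obtain h' | h' | h' := hM
      · exact mul_right_cancel₀ h' (by linear_combination -h01)
      · exact mul_right_cancel₀ h' (by linear_combination -h10)
      · exact mul_right_cancel₀ (sub_ne_zero.2 h') (by linear_combination h11 - h00)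
  · obtain ⟨t, -, c, -, -, h⟩ := hquad
      (Matrix.single ⟨0, by omega⟩ ⟨1, by omega⟩ 1 + Matrix.single ⟨1, by omega⟩ ⟨2, by omega⟩ 1)
    have h02 := congr($h ⟨0, by omega⟩ ⟨2, by omega⟩)
    simp [add_mul, mul_add] at h02
end

section
/- Let A be a unital semiprime ring with center Z (semiprime meaning: for every a ∈ A, if a·x·a = 0 for all x ∈ A, then a = 0), and let ⋆ be an involution on A. Then x + x^⋆ ∈ Z for every x ∈ A if and only if x·x^⋆ ∈ Z for every x ∈ A. -/
/-- Let `A` be a unital semiprime ring with center `Z` and `σ` an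
involution on `A`. Then `x + σ x ∈ Z` for all `x` iff `x * σ x ∈ Z` for all `x`. -/
theorem semiprime_traces_central_iff_norms_central (A : Type*) [Ring A]
    (hsemiprime : ∀ a : A, (∀ x : A, a * x * a = 0) → a = 0)
    (σ : A → A)
    (hadd : ∀ x y : A, σ (x + y) = σ x + σ y)
    (hmul : ∀ x y : A, σ (x * y) = σ y * σ x)
    (hinvo : ∀ x : A, σ (σ x) = x) :
    (∀ x : A, x + σ x ∈ Subring.center A) ↔ (∀ x : A, x * σ x ∈ Subring.center A) := by
  have hone : σ 1 = 1 := by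
    simpa [hinvo] using (hmul (σ 1) 1).symm
  constructor
  · intro htrace x
    rw [Subring.mem_center_iff]
    intro y
    have hx := Subring.mem_center_iff.mp (htrace x)
    have hy := Subring.mem_center_iff.mp (htrace y)
    have hxy := Subring.mem_center_iff.mp (htrace (x * y)) x
    obtain ⟨t, ht⟩ : ∃ t, t = x + σ x := ⟨_, rfl⟩
    obtain ⟨u, hu⟩ : ∃ u, u = y + σ y := ⟨_, rfl⟩
    have hσx : σ x = t - x := by rw [ht]; abel
    have hσy : σ y = u - y := by rw [hu]; abel
    rw [← ht] at hx
    rw [← hu] at hy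
    rw [hmul, hσx, hσy] at hxy
    rw [hσx]
    -- the commutator of `x` with the trace of `x * y` equals that of `x * σ x` with `y`
    have key : y * (x * (t - x)) - x * (t - x) * y
        = x * (x * y + (u - y) * (t - x)) - (x * y + (u - y) * (t - x)) * x := by
      have h₁ : x * (u - y) = u * x - x * y := by rw [mul_sub, hy]
      have h₂ : (t - x) * x = x * (t - x) := by rw [mul_sub, sub_mul, hx]
      have h₃ : (t - x) * y = y * t - x * y := by rw [sub_mul, hx]
      rw [mul_add, add_mul, mul_assoc (u - y), h₂, ← mul_assoc x (u - y), h₁,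
        mul_assoc x (t - x) y, h₃]
      noncomm_ring
    rw [← sub_eq_zero, key, hxy, sub_self]
  · intro hnorm x
    have h : x + σ x = (1 + x) * σ (1 + x) - 1 - x * σ x := by
      rw [hadd, hone]
      noncomm_ring
    rw [h]
    exact sub_mem (sub_mem (hnorm _) (one_mem _)) (hnorm x)
end

section
/- Let D be a division ring with center F, let n be a positive integer, and let ⋆ be an involution of the first kind on M_n(D). If x + x^⋆ lies in the center of M_n(D) for every x ∈ M_n(D), then D is centrally finite, i.e., D is a finite-dimensional vector space over F. -/
/-- If `d ↦ a * d + d * b` is nonzero and takes values in a finite-dimensional subspace, then the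
division ring is centrally finite. -/
theorem DivisionRing.finite_center_of_mul_add_mul_mem {D : Type*} [DivisionRing D] (a b : D)
    (W : Submodule (Subring.center D) D) (hW : W.FG) (h : ∀ d, a * d + d * b ∈ W)
    {d₀ : D} (hd₀ : a * d₀ + d₀ * b ≠ 0) : Module.Finite (Subring.center D) D := by
  let φ : D →ₗ[Subring.center D] D :=
    LinearMap.mulLeft (Subring.center D) a + LinearMap.mulRight (Subring.center D) b
  have hφ (d : D) : φ d = a * d + d * b := rfl
  let C : Submodule (Subring.center D) D :=
    LinearMap.ker (LinearMap.mulLeft (Subring.center D) a - LinearMap.mulRight (Subring.center D) a)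
  have hC {c : D} : c ∈ C ↔ a * c = c * a := by simp [C, sub_eq_zero]
  have hCfg : C.FG := by
    refine (hW.map (LinearMap.mulRight (Subring.center D) (a * d₀ + d₀ * b)⁻¹)).of_le
      fun c hc ↦ ⟨a * (c * d₀) + c * d₀ * b, h _, ?_⟩
    have : a * (c * d₀) + c * d₀ * b = c * (a * d₀ + d₀ * b) := by
      rw [← mul_assoc, hC.1 hc]; noncomm_ring
    simp [this, hd₀]
  have hker : (LinearMap.ker φ).FG := by
    by_cases hbot : LinearMap.ker φ = ⊥
    · rw [hbot]; exact Submodule.fg_bot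
    obtain ⟨u, hu, hu0⟩ := (Submodule.ne_bot_iff _).1 hbot
    have hub : b * u⁻¹ = -(u⁻¹ * a) := by
      rw [LinearMap.mem_ker, hφ, add_comm] at hu
      have hu' : b = -(u⁻¹ * a * u) := by
        rw [mul_assoc, ← mul_neg, ← eq_neg_of_add_eq_zero_left hu, inv_mul_cancel_left₀ hu0]
      rw [hu', neg_mul, mul_inv_cancel_right₀ hu0]
    refine (hCfg.map (LinearMap.mulRight (Subring.center D) u)).of_le
      fun v hv ↦ ⟨v * u⁻¹, hC.2 ?_, by simp [hu0]⟩
    rw [LinearMap.mem_ker, hφ] at hv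
    rw [← mul_assoc, eq_neg_of_add_eq_zero_left hv, neg_mul, mul_assoc, hub]
    noncomm_ring
  refine ⟨Submodule.fg_of_fg_map_of_fg_inf_ker φ (hW.of_le ?_) (by simpa using hker)⟩
  rintro _ ⟨d, -, rfl⟩
  exact h d

/-- A central matrix over a division ring is scalar, with central entry. -/
theorem Matrix.exists_scalar_eq_of_mem_center {D ι : Type*} [Ring D] [Fintype ι]
    [DecidableEq ι] {z : Matrix ι ι D} (hz : z ∈ Subring.center (Matrix ι ι D)) :
    ∃ c ∈ Subring.center D, Matrix.scalar ι c = z := by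
  rwa [Matrix.subringCenter_eq_scalar_map] at hz

theorem Matrix.scalar_mem_center {D ι : Type*} [Ring D] [Fintype ι]
    [DecidableEq ι] {c : D} (hc : c ∈ Subring.center D) :
    Matrix.scalar ι c ∈ Subring.center (Matrix ι ι D) := by
  rw [Matrix.subringCenter_eq_scalar_map]
  exact ⟨c, hc, rfl⟩

/-- If `k` is a noncentral matrix such that every `x * k + k * x` is a combination of `1` and `k`
with central coefficients, then the base division ring is centrally finite. -/
theorem Matrix.finite_center_of_mul_add_mul_mem {D ι : Type*} [DivisionRing D] [Fintype ι]
    [DecidableEq ι] {k : Matrix ι ι D} (hk : k ∉ Subring.center (Matrix ι ι D))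
    (h : ∀ x, ∃ z ∈ Subring.center (Matrix ι ι D), ∃ w ∈ Subring.center (Matrix ι ι D),
      x * k + k * x = z + w * k) : Module.Finite (Subring.center D) D := by
  by_contra hfin
  have key (i j l : ι) (d : D) : (if l = j then k i i else 0) * d + d * k j l = 0 := by
    by_contra hne
    refine hfin (DivisionRing.finite_center_of_mul_add_mul_mem _ _
      (Submodule.span _ {1, k i l}) (Submodule.fg_span (by simp)) (fun e ↦ ?_) hne)
    obtain ⟨z, hz, w, hw, hzw⟩ := h (Matrix.single i j e)
    obtain ⟨c, hc, rfl⟩ := Matrix.exists_scalar_eq_of_mem_center hz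
    obtain ⟨c', hc', rfl⟩ := Matrix.exists_scalar_eq_of_mem_center hw
    have hent := congrFun (congrFun hzw i) l
    have hleft : (Matrix.single i j e * k + k * Matrix.single i j e) i l =
        (if l = j then k i i else 0) * e + e * k j l := by
      rw [Matrix.add_apply, Matrix.single_mul_apply_same, add_comm]
      split_ifs with hlj
      · subst hlj; rw [Matrix.mul_single_apply_same]
      · rw [Matrix.mul_single_apply_of_ne (hbj := hlj), zero_mul]
    rw [← hleft, hent, Submodule.mem_span_pair]
    refine ⟨⟨if i = l then c else 0, ?_⟩, ⟨c', hc'⟩, ?_⟩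
    · split_ifs
      exacts [hc, zero_mem _]
    · simp [Subring.smul_def, Matrix.diagonal_apply]
  have hoff {j l : ι} (hjl : l ≠ j) : k j l = 0 := by simpa [hjl] using key j j l 1
  have hdiag (i j : ι) (d : D) : k i i * d = d * k j j := by
    have h1 := key i j j d
    have h2 := congrArg (d * ·) (key j j j 1)
    simp only [if_true, mul_one, one_mul, mul_zero, mul_add] at h1 h2
    exact add_right_cancel (h1.trans h2.symm)
  have hkd : k = Matrix.diagonal fun i ↦ k i i := by
    ext i j
    by_cases hij : i = j
    · subst hij; simp
    · rw [Matrix.diagonal_apply_ne _ hij, hoff (Ne.symm hij)]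
  refine hk (Subring.mem_center_iff.2 fun x ↦ ?_)
  rw [hkd]
  ext i j
  rw [Matrix.mul_diagonal, Matrix.diagonal_mul, hdiag i j]

/-- Let `D` be a division ring with center `F`, `n` a positive integer,
and `σ` an involution of the first kind on `M_n(D)`. If `x + σ x` is central for
every `x ∈ M_n(D)`, then `D` is centrally finite, i.e. finite-dimensional over
`F`. -/
theorem centrally_finite_of_matrix_symplectic (D : Type*) [DivisionRing D]
    (n : ℕ) (hn : 0 < n)
    (σ : Matrix (Fin n) (Fin n) D → Matrix (Fin n) (Fin n) D)
    (hadd : ∀ x y, σ (x + y) = σ x + σ y)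
    (hmul : ∀ x y, σ (x * y) = σ y * σ x)
    (hinvo : ∀ x, σ (σ x) = x)
    (hfirst : ∀ x ∈ Subring.center (Matrix (Fin n) (Fin n) D), σ x = x)
    (htr : ∀ x : Matrix (Fin n) (Fin n) D,
      x + σ x ∈ Subring.center (Matrix (Fin n) (Fin n) D)) :
    Module.Finite (Subring.center D) D := by
  have : NeZero n := ⟨hn.ne'⟩
  by_cases hK : ∀ k, k + σ k = 0 → k ∈ Subring.center (Matrix (Fin n) (Fin n) D)
  · let t : D →ₗ[Subring.center D] D :=
      { toFun d := (Matrix.scalar (Fin n) d + σ (Matrix.scalar (Fin n) d)) 0 0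
        map_add' x y := by
          rw [map_add, hadd, add_add_add_comm, Matrix.add_apply]
        map_smul' c x := by
          have hc := Matrix.scalar_mem_center (ι := Fin n) c.2
          rw [Subring.smul_def, smul_eq_mul, map_mul, hmul, hfirst _ hc,
            Subring.mem_center_iff.1 hc, ← mul_add]
          simp [Subring.smul_def, mul_add] }
    have hone : (Submodule.span (Subring.center D) {(1 : D)}).FG := Submodule.fg_span (by simp)
    refine ⟨Submodule.fg_of_fg_map_of_fg_inf_ker t (hone.of_le ?_) (hone.of_le ?_)⟩
    · rintro _ ⟨d, -, rfl⟩
      obtain ⟨c, hc, hcd⟩ := Matrix.exists_scalar_eq_of_mem_center (htr (Matrix.scalar (Fin n) d))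
      refine Submodule.mem_span_singleton.2 ⟨⟨c, hc⟩, ?_⟩
      change c * 1 = (Matrix.scalar (Fin n) d + σ (Matrix.scalar (Fin n) d)) 0 0
      rw [← hcd]
      simp
    · rintro d ⟨-, hd⟩
      obtain ⟨c, hc, hcd⟩ := Matrix.exists_scalar_eq_of_mem_center (htr (Matrix.scalar (Fin n) d))
      have hd' : (Matrix.scalar (Fin n) d + σ (Matrix.scalar (Fin n) d)) 0 0 = 0 := hd
      rw [← hcd] at hd'
      have hc0 : c = 0 := by simpa using hd'
      rw [hc0, map_zero] at hcd
      obtain ⟨e, he, hed⟩ := Matrix.exists_scalar_eq_of_mem_center (hK _ hcd.symm)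
      refine Submodule.mem_span_singleton.2 ⟨⟨e, he⟩, ?_⟩
      simpa [Subring.smul_def] using congrFun (congrFun hed 0) 0
  · push Not at hK
    obtain ⟨k, hk, hkc⟩ := hK
    refine Matrix.finite_center_of_mul_add_mul_mem hkc fun x ↦
      ⟨_, htr (x * k), _, htr x, ?_⟩
    rw [hmul, eq_neg_of_add_eq_zero_right hk, ← Subring.mem_center_iff.1 (htr x) k]
    noncomm_ring
end

section
/- Let D be a division ring with center F, let G be a non-central subnormal subgroup of the multiplicative group D^×, and let ⋆ be an involution of the first kind on D. Then g·g^⋆ ∈ F for every g ∈ G if and only if x·x^⋆ ∈ F for every x ∈ D (i.e., ⋆ is scalar). -/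
/-- A subgroup `G` of a group `Γ` is subnormal if there is a finite chain of
subgroups `G = G_r ⊴ G_{r-1} ⊴ ⋯ ⊴ G_0 = Γ` in which each term is a normal
subgroup of the next. -/
def Subgroup.IsSubnormal' {Γ : Type*} [Group Γ] (G : Subgroup Γ) : Prop :=
  ∃ (r : ℕ) (c : Fin (r + 1) → Subgroup Γ), c 0 = G ∧ c (Fin.last r) = ⊤ ∧
    ∀ i : Fin r, c i.castSucc ≤ c i.succ ∧
      ∀ h ∈ c i.castSucc, ∀ g ∈ c i.succ, g * h * g⁻¹ ∈ c i.castSucc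

open scoped commutatorElement

/-- If the `m`-th difference of an `n`-periodic sequence vanishes, then its first difference is
killed by `n ^ m`. -/
theorem pow_nsmul_fwdDiff_eq_zero_of_periodic {M : Type*} [AddCommGroup M] (n m : ℕ) :
    ∀ X : ℕ → M, (fwdDiff 1)^[m] X = 0 → (∀ i, X (i + n) = X i) →
      ∀ i, n ^ m • fwdDiff 1 X i = 0 := by
  induction m with
  | zero =>
    intro X h0 _ i
    have : X = 0 := h0
    simp [this, fwdDiff]
  | succ m ih =>
    intro X h0 hper i
    have h1 := ih (fwdDiff 1 X) h0 fun i => by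
      simp only [fwdDiff]
      rw [show i + n + 1 = i + 1 + n by ring, hper, hper]
    have hconst : ∀ j, n ^ m • fwdDiff 1 X (i + j) = n ^ m • fwdDiff 1 X i := by
      intro j
      induction j with
      | zero => rfl
      | succ j hj =>
        have := h1 (i + j)
        rw [fwdDiff, smul_sub, sub_eq_zero] at this
        rw [← hj, ← this]; rfl
    have hlin : ∀ j, n ^ m • (X (i + j) - X i) = j • n ^ m • fwdDiff 1 X i := by
      intro j
      induction j with
      | zero => simp
      | succ j hj =>
        rw [add_smul, one_smul, ← hj, ← hconst j, ← smul_add, fwdDiff]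
        congr 1
        rw [add_assoc]; abel
    have := hlin n
    rw [hper, sub_self, smul_zero] at this
    rw [pow_succ', mul_smul, ← this]

/-- A sequence whose `m`-th difference vanishes satisfies a relation with nonnegative
coefficients in which the initial term occurs on one side only, with coefficient one. -/
theorem sum_even_choose_nsmul_eq_of_fwdDiff {M : Type*} [AddCommGroup M] (m : ℕ) (X : ℕ → M)
    (h : (fwdDiff 1)^[m] X 0 = 0) :
    ∑ k ∈ Finset.range (m + 1), (if Even k then m.choose k else 0) • X k =
      ∑ k ∈ Finset.range (m + 1), (if Even k then 0 else m.choose k) • X k := by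
  rw [fwdDiff_iter_eq_sum_shift] at h
  rw [← sub_eq_zero, ← Finset.sum_sub_distrib]
  have h2 : (-1 : ℤ) ^ m • ∑ k ∈ Finset.range (m + 1),
      ((-1 : ℤ) ^ (m - k) * m.choose k) • X (0 + k • 1) = 0 := by rw [h, smul_zero]
  rw [Finset.smul_sum] at h2
  rw [← h2]
  refine Finset.sum_congr rfl fun k hk => ?_
  have hk' : k ≤ m := by simpa [Nat.lt_succ_iff] using hk
  obtain ⟨j, rfl⟩ := Nat.exists_eq_add_of_le hk'
  rw [smul_smul, ← mul_assoc, ← pow_add, Nat.add_sub_cancel_left,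
    show k + j + j = k + 2 * j by ring, pow_add, pow_mul]
  by_cases hev : Even k
  · simp [hev]
  · simp [hev, (Nat.not_even_iff_odd.mp hev).neg_one_pow]

section Heisenberg

variable {E D : Type*} [Field E] [DivisionRing D]

/-- Let `a` act on the image of a field `E` so that `b ↦ μ * b`, fixing `μ` and infinitely many
other elements. If all `m`-fold commutators with `a` are trivial then `μ = 1`. -/
theorem eq_one_of_iterate_commutator_eq_one (ι : E →+* D) (a : Dˣ) (b μ : E) (hb0 : b ≠ 0)
    (hb : (a : D) * ι b = ι (μ * b) * a) (hμ : Commute (a : D) (ι μ))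
    (I : Set E) (hI : I.Infinite) (hIa : ∀ c ∈ I, Commute (a : D) (ι c)) (m : ℕ)
    (hm : ∀ f : Dˣ, (fun y => ⁅a, y⁆)^[m] f = 1) : μ = 1 := by
  have hstep : ∀ c ∈ I, ∀ k : ℕ, (a : D) * ι (c + μ ^ k * b) = ι (c + μ ^ (k + 1) * b) * a := by
    intro c hc k
    have h2 := (hμ.pow_right k).eq
    simp only [map_add, map_mul, map_pow] at hb ⊢
    rw [mul_add, add_mul, (hIa c hc).eq, ← mul_assoc, h2, mul_assoc, hb, pow_succ]
    simp only [mul_assoc]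
  have hne : ∀ c ∈ I, c + b ≠ 0 → ∀ k : ℕ, c + μ ^ k * b ≠ 0 := by
    intro c hc h0 k
    induction k with
    | zero => simpa using h0
    | succ k ih =>
      intro h
      have := hstep c hc k
      rw [h, map_zero, zero_mul] at this
      exact (mul_ne_zero a.ne_zero ((map_ne_zero ι).mpr ih)) this
  have key : ∀ c (hc : c ∈ I) (h0 : c + b ≠ 0),
      (fwdDiff 1)^[m] (fun k => Additive.ofMul (Units.mk0 _ (hne c hc h0 k))) = 0 := by
    intro c hc h0
    set X : ℕ → Additive Eˣ := fun k => Additive.ofMul (Units.mk0 _ (hne c hc h0 k)) with hX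
    let φ : Eˣ →* Dˣ := Units.map (ι : E →* D)
    have hφ : Function.Injective φ := Units.map_injective ι.injective
    have hconj : ∀ k, a * φ (X k).toMul * a⁻¹ = φ (X (k + 1)).toMul := by
      intro k
      rw [mul_inv_eq_iff_eq_mul]
      exact Units.ext (hstep c hc k)
    have hconj' : ∀ j k, a * φ ((fwdDiff 1)^[j] X k).toMul * a⁻¹ =
        φ ((fwdDiff 1)^[j] X (k + 1)).toMul := by
      intro j
      induction j with
      | zero => exact hconj
      | succ j ih =>
        intro k
        rw [Function.iterate_succ_apply']
        simp only [fwdDiff, toMul_sub, map_div]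
        rw [← ih (k + 1), ← ih k]
        simp [div_eq_mul_inv, mul_assoc]
    have hiter : ∀ j k, (fun y => ⁅a, y⁆)^[j] (φ (X k).toMul) =
        φ ((fwdDiff 1)^[j] X k).toMul := by
      intro j k
      induction j with
      | zero => rfl
      | succ j ih =>
        rw [Function.iterate_succ_apply', Function.iterate_succ_apply', ih]
        simp only [fwdDiff, toMul_sub, map_div, commutatorElement_def]
        rw [hconj', div_eq_mul_inv]
    funext k
    have := hiter m k
    rw [hm] at this
    have h1 : ((fwdDiff 1)^[m] X k).toMul = 1 := hφ (by rw [← this, map_one])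
    simpa using h1
  have hinf : (I \ {-b}).Infinite := hI.sdiff (Set.finite_singleton _)
  have hI' : ∀ c ∈ I \ {-b}, c + b ≠ 0 := fun c hc h => hc.2 (eq_neg_of_add_eq_zero_left h)
  by_contra hμ1
  by_cases hfin : ∃ n, 0 < n ∧ μ ^ n = 1
  · obtain ⟨n, hn, hμn⟩ := hfin
    have hN : 0 < n ^ m := pow_pos hn m
    have hpoly : (Polynomial.X + Polynomial.C (μ * b)) ^ n ^ m =
        (Polynomial.X + Polynomial.C b) ^ n ^ m := by
      refine Polynomial.eq_of_infinite_eval_eq _ _ (hinf.mono fun c hc => ?_)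
      have := pow_nsmul_fwdDiff_eq_zero_of_periodic n m _ (key c hc.1 (hI' c hc))
        (fun i => by simp only [pow_add, hμn, mul_one]) 0
      have h2 := congrArg (fun u : Additive Eˣ => ((u.toMul : Eˣ) : E)) this
      simp only [fwdDiff, toMul_nsmul, toMul_sub, toMul_ofMul, toMul_zero, Units.val_pow_eq_pow_val,
        Units.val_div_eq_div_val, Units.val_mk0, Units.val_one, zero_add, pow_zero, pow_one, one_mul,
        div_pow] at h2
      rw [div_eq_one_iff_eq (pow_ne_zero _ (hI' c hc))] at h2
      simpa using h2
    have := congrArg (Polynomial.eval (-b)) hpoly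
    simp only [Polynomial.eval_pow, Polynomial.eval_add, Polynomial.eval_X, Polynomial.eval_C,
      neg_add_cancel, zero_pow hN.ne'] at this
    have h3 := eq_zero_of_pow_eq_zero this
    apply hμ1
    have h4 : (μ - 1) * b = 0 := by rw [← h3]; ring
    rcases mul_eq_zero.mp h4 with h | h
    · exact sub_eq_zero.mp h
    · exact absurd h hb0
  · push Not at hfin
    have hpoly : ∏ k ∈ Finset.range (m + 1), (Polynomial.X + Polynomial.C (μ ^ k * b)) ^
          (if Even k then m.choose k else 0) =
        ∏ k ∈ Finset.range (m + 1), (Polynomial.X + Polynomial.C (μ ^ k * b)) ^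
          (if Even k then 0 else m.choose k) := by
      refine Polynomial.eq_of_infinite_eval_eq _ _ (hinf.mono fun c hc => ?_)
      have := sum_even_choose_nsmul_eq_of_fwdDiff m _ (congrFun (key c hc.1 (hI' c hc)) 0)
      have h2 := congrArg (fun u : Additive Eˣ => ((u.toMul : Eˣ) : E)) this
      simp only [toMul_sum, toMul_nsmul, Units.coe_prod, Units.val_pow_eq_pow_val, toMul_ofMul,
        Units.val_mk0] at h2
      simpa only [Set.mem_ofPred_eq, Polynomial.eval_prod, Polynomial.eval_pow, Polynomial.eval_add,
        Polynomial.eval_X, Polynomial.eval_C] using h2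
    have := congrArg (Polynomial.eval (-b)) hpoly
    simp only [Polynomial.eval_prod, Polynomial.eval_pow, Polynomial.eval_add, Polynomial.eval_X,
      Polynomial.eval_C] at this
    rw [Finset.prod_eq_zero (Finset.mem_range.mpr (Nat.succ_pos m)) (by simp)] at this
    obtain ⟨k, -, hk⟩ := Finset.prod_eq_zero_iff.mp this.symm
    obtain ⟨h3, h4⟩ := pow_eq_zero_iff'.mp hk
    have hk0 : 0 < k := by
      rcases Nat.eq_zero_or_pos k with rfl | h
      · simp at h4
      · exact h
    refine hfin k hk0 ?_
    have h5 : (μ ^ k - 1) * b = 0 := by rw [← h3]; ring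
    rcases mul_eq_zero.mp h5 with h | h
    · exact sub_eq_zero.mp h
    · exact absurd h hb0

end Heisenberg

namespace Subgroup

variable {Γ : Type*} [Group Γ]

/-- `G` is reached from the whole group by a chain of `n` successive normal subgroups. -/
def IsSubnormalOfDepth : ℕ → Subgroup Γ → Prop
  | 0, G => G = ⊤
  | n + 1, G => ∃ H, IsSubnormalOfDepth n H ∧ G ≤ H ∧ ∀ h ∈ H, ∀ g ∈ G, h * g * h⁻¹ ∈ G

theorem IsSubnormalOfDepth.iterate_commutator_mem {n : ℕ} :
    ∀ {G : Subgroup Γ}, IsSubnormalOfDepth n G → ∀ {a}, a ∈ G → ∀ f : Γ,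
      (fun y => ⁅a, y⁆)^[n] f ∈ G := by
  induction n with
  | zero =>
    intro G hG a _ f
    rw [show G = ⊤ from hG]
    trivial
  | succ n ih =>
    rintro G ⟨H, hH, hGH, hn⟩ a ha f
    rw [Function.iterate_succ_apply', commutatorElement_def, mul_assoc, mul_assoc, ← mul_assoc _ a⁻¹]
    exact G.mul_mem ha (hn _ (ih hH (hGH ha) f) _ (G.inv_mem ha))

end Subgroup

open Subgroup

section Group

variable {Γ : Type*} [Group Γ]

theorem pow_mul_eq_commutatorElement_pow_mul {a b : Γ} (ha : Commute a ⁅a, b⁆) (k : ℕ) :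
    a ^ k * b = ⁅a, b⁆ ^ k * b * a ^ k := by
  induction k with
  | zero => simp
  | succ k ih =>
    have h : a * b = ⁅a, b⁆ * b * a := by simp [commutatorElement_def]
    rw [pow_succ', mul_assoc, ih, mul_assoc, ← mul_assoc a, (ha.pow_right k).eq, mul_assoc,
      ← mul_assoc a b, h, pow_succ]
    simp only [mul_assoc]

theorem mul_pow_eq_commutatorElement_pow_mul {a b : Γ} (hb : Commute b ⁅a, b⁆) (k : ℕ) :
    a * b ^ k = ⁅a, b⁆ ^ k * b ^ k * a := by
  induction k with
  | zero => simp
  | succ k ih =>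
    have h : a * b = ⁅a, b⁆ * b * a := by simp [commutatorElement_def]
    rw [pow_succ, ← mul_assoc, ih, mul_assoc, h, pow_succ]
    have := (hb.symm.pow_right k).eq
    simp only [← mul_assoc]
    rw [mul_assoc _ (b ^ k), ← this]
    simp only [← mul_assoc]

end Group

section DivisionRing

variable {D : Type*} [DivisionRing D]

theorem not_isOfFinOrder_of_commutatorElement {a b : Dˣ} (h1 : ⁅a, b⁆ ≠ 1)
    (ha : Commute a ⁅a, b⁆) (hb : Commute b ⁅a, b⁆) (p : ℕ) [Fact p.Prime] [CharP D p] :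
    ¬ (IsOfFinOrder a ∧ IsOfFinOrder b ∧ IsOfFinOrder ⁅a, b⁆) := by
  rintro ⟨fa, fb, fμ⟩
  set μ := ⁅a, b⁆ with hμ
  let S : Set Dˣ := {u | ∃ m ∈ zpowers μ, ∃ i : ℕ, ∃ y ∈ zpowers b, u = m * a ^ i * y}
  have hS : S.Finite := by
    have f1 : (zpowers μ : Set Dˣ).Finite := by simpa using fμ
    have f2 : (zpowers a : Set Dˣ).Finite := by simpa using fa
    have f3 : (zpowers b : Set Dˣ).Finite := by simpa using fb
    refine ((f1.mul f2).mul f3).subset ?_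
    rintro u ⟨m, hm, i, y, hy, rfl⟩
    exact Set.mul_mem_mul (Set.mul_mem_mul hm (npow_mem_zpowers a i)) hy
  have hcl : (Submonoid.closure {(a : D), (b : D)} : Set D) ⊆ Units.val '' S := by
    intro x hx
    induction hx using Submonoid.closure_induction_left with
    | one => exact ⟨1, ⟨1, one_mem _, 0, 1, one_mem _, by simp⟩, rfl⟩
    | mul_left x hx y _ ih =>
      obtain ⟨u, ⟨m, hm, i, y, hy, rfl⟩, rfl⟩ := ih
      obtain ⟨k, rfl⟩ := mem_zpowers_iff.mp hm
      rcases hx with rfl | rfl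
      · refine ⟨_, ⟨μ ^ k, ⟨k, rfl⟩, i + 1, y, hy, rfl⟩, ?_⟩
        rw [← Units.val_mul, ← mul_assoc, ← mul_assoc, (ha.zpow_right k).eq, pow_succ']
        simp only [mul_assoc]
      · refine ⟨_, ⟨μ ^ k * (μ ^ i)⁻¹, mul_mem ⟨k, rfl⟩ (inv_mem (npow_mem_zpowers μ i)), i, b * y,
          mul_mem (mem_zpowers b) hy, rfl⟩, ?_⟩
        have h2 : b * a ^ i = (μ ^ i)⁻¹ * (a ^ i * b) := by
          rw [pow_mul_eq_commutatorElement_pow_mul ha i, ← hμ]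
          simp only [mul_assoc, inv_mul_cancel_left]
        have h3 : b * (μ ^ k * a ^ i * y) = μ ^ k * (b * a ^ i) * y := by
          rw [← mul_assoc, ← mul_assoc, (hb.zpow_right k).eq, mul_assoc (μ ^ k)]
        rw [← Units.val_mul, h3, h2]
        simp only [mul_assoc]
  let := ZMod.algebra D p
  have hfd : Module.Finite (ZMod p) (Algebra.adjoin (ZMod p) {(a : D), (b : D)}) := by
    change Module.Finite (ZMod p) (Subalgebra.toSubmodule (Algebra.adjoin (ZMod p) {(a : D), (b : D)}))
    rw [Algebra.adjoin_eq_span]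
    exact FiniteDimensional.span_of_finite _ ((hS.image _).subset hcl)
  have : Finite (Algebra.adjoin (ZMod p) {(a : D), (b : D)}) := Module.finite_of_finite (ZMod p)
  have hc := (Finite.isDomain_to_isField (Algebra.adjoin (ZMod p) {(a : D), (b : D)})).mul_comm
    ⟨a, Algebra.subset_adjoin (by simp)⟩ ⟨b, Algebra.subset_adjoin (by simp)⟩
  have hc' : (a : D) * b = b * a := congrArg Subtype.val hc
  exact h1 (commutatorElement_eq_one_iff_mul_comm.mpr (Units.ext hc'))

theorem exists_infinite_commute_of_not_isOfFinOrder {a b τ : Dˣ} (ha : Commute a τ)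
    (hb : Commute b τ) (hτ : ¬ IsOfFinOrder τ) :
    ∃ I : Set D, I.Infinite ∧ (∀ x ∈ I, ∀ y ∈ I, Commute x y) ∧
      ∀ x ∈ I, Commute (a : D) x ∧ Commute (b : D) x := by
  refine ⟨Set.range fun i : ℕ => ((τ ^ i : Dˣ) : D), Set.infinite_range_of_injective
    (Units.val_injective.comp (injective_pow_iff_not_isOfFinOrder.mpr hτ)), ?_, ?_⟩
  · rintro _ ⟨i, rfl⟩ _ ⟨j, rfl⟩
    exact (Commute.pow_pow_self τ i j).units_val
  · rintro _ ⟨i, rfl⟩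
    exact ⟨(ha.pow_right i).units_val, (hb.pow_right i).units_val⟩

theorem exists_infinite_commute_of_commutatorElement_ne_one {a b : Dˣ} (h1 : ⁅a, b⁆ ≠ 1)
    (ha : Commute a ⁅a, b⁆) (hb : Commute b ⁅a, b⁆) :
    ∃ I : Set D, I.Infinite ∧ (∀ x ∈ I, ∀ y ∈ I, Commute x y) ∧
      ∀ x ∈ I, Commute (a : D) x ∧ Commute (b : D) x := by
  rcases CharP.exists' D with h0 | ⟨p, hp, hD⟩
  · refine ⟨Set.range (Nat.cast : ℕ → D), Set.infinite_range_of_injective Nat.cast_injective, ?_, ?_⟩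
    · rintro _ ⟨i, rfl⟩ _ ⟨j, rfl⟩
      exact Nat.cast_commute i _
    · rintro _ ⟨i, rfl⟩
      exact ⟨Nat.commute_cast _ i, Nat.commute_cast _ i⟩
  · by_cases fμ : IsOfFinOrder ⁅a, b⁆
    swap
    · exact exists_infinite_commute_of_not_isOfFinOrder ha hb fμ
    have hn := fμ.orderOf_pos
    set n := orderOf ⁅a, b⁆ with hn'
    have hμn : ⁅a, b⁆ ^ n = 1 := pow_orderOf_eq_one _
    by_cases fa : IsOfFinOrder a
    swap
    · refine exists_infinite_commute_of_not_isOfFinOrder (τ := a ^ n) (Commute.self_pow a n) ?_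
        (fun h => fa ((isOfFinOrder_pow).mp h |>.resolve_right hn.ne'))
      have := pow_mul_eq_commutatorElement_pow_mul ha n
      rw [hμn, one_mul] at this
      exact this.symm
    by_cases fb : IsOfFinOrder b
    swap
    · refine exists_infinite_commute_of_not_isOfFinOrder (τ := b ^ n) ?_ (Commute.self_pow b n)
        (fun h => fb ((isOfFinOrder_pow).mp h |>.resolve_right hn.ne'))
      have := mul_pow_eq_commutatorElement_pow_mul hb n
      rwa [hμn, one_mul] at this
    exact absurd ⟨fa, fb, fμ⟩ (not_isOfFinOrder_of_commutatorElement h1 ha hb p)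

/-- The centralizer of a subset of a division ring, as a division subring. -/
def Subfield.centralizer (S : Set D) : Subfield D where
  __ := Subring.centralizer S
  inv_mem' _ hx := Set.inv_mem_centralizer₀ hx

theorem Subfield.mem_centralizer {S : Set D} {x : D} :
    x ∈ Subfield.centralizer S ↔ ∀ s ∈ S, s * x = x * s := Iff.rfl

theorem commutatorElement_eq_one_of_iterate {a b : Dˣ} (ha : Commute a ⁅a, b⁆)
    (hb : Commute b ⁅a, b⁆) (m : ℕ) (hm : ∀ f : Dˣ, (fun y => ⁅a, y⁆)^[m] f = 1) : ⁅a, b⁆ = 1 := by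
  by_contra h1
  obtain ⟨I, hI, hII, hIab⟩ := exists_infinite_commute_of_commutatorElement_ne_one h1 ha hb
  set μ := ⁅a, b⁆ with hμ
  have hμI : ∀ x ∈ I, Commute (μ : D) x := by
    intro x hx
    have h1 := (hIab x hx).1
    have h2 := (hIab x hx).2
    rw [hμ, commutatorElement_def]
    simp only [Units.val_mul, Units.val_inv_eq_inv_val]
    exact ((h1.mul_left h2).mul_left h1.inv_left₀).mul_left h2.inv_left₀
  let T : Set D := {(b : D), (μ : D)} ∪ I
  have hT : ∀ x ∈ T, ∀ y ∈ T, Commute x y := by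
    have hbμ : Commute (b : D) μ := hb.units_val
    rintro x ((rfl | rfl) | hx) y ((rfl | rfl) | hy)
    · exact Commute.refl _
    · exact hbμ
    · exact (hIab y hy).2
    · exact hbμ.symm
    · exact Commute.refl _
    · exact hμI y hy
    · exact (hIab x hx).2.symm
    · exact (hμI x hx).symm
    · exact hII x hx y hy
  let E := Subfield.centralizer (Subfield.centralizer T : Set D)
  have hTE : ∀ x ∈ T, x ∈ E := fun x hx y hy => (hy x hx).symm
  have hE : ∀ x y : E, x * y = y * x := by
    rintro ⟨x, hx⟩ ⟨y, hy⟩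
    have hxT : x ∈ Subfield.centralizer T := fun t ht => hx t fun s hs => hT s hs t ht
    exact Subtype.ext (hy x hxT)
  let : Field E := { (inferInstance : DivisionRing E) with mul_comm := hE }
  have hIE : I ⊆ Set.range E.subtype := fun x hx => ⟨⟨x, hTE x (Or.inr hx)⟩, rfl⟩
  have := eq_one_of_iterate_commutator_eq_one E.subtype a ⟨b, hTE _ (by simp [T])⟩
    ⟨μ, hTE _ (by simp [T])⟩ (fun h => b.ne_zero (congrArg Subtype.val h)) ?_ ha.units_val
    (E.subtype ⁻¹' I) (hI.preimage hIE) (fun c hc => (hIab _ hc).1) m hm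
  · exact h1 (Units.ext (congrArg Subtype.val this))
  · change (a : D) * b = μ * b * a
    rw [← Units.val_mul, ← Units.val_mul, ← Units.val_mul, hμ]
    simp [commutatorElement_def]

theorem Subgroup.IsSubnormalOfDepth.commute_of_commute_commutatorElement {n : ℕ}
    {Q : Subgroup Dˣ} (hQ : IsSubnormalOfDepth n Q)
    (h : ∀ a ∈ Q, ∀ b ∈ Q, ∀ c ∈ Q, Commute c ⁅a, b⁆) : ∀ a ∈ Q, ∀ b ∈ Q, Commute a b := by
  intro a ha b hb
  refine commutatorElement_eq_one_iff_commute.mp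
    (commutatorElement_eq_one_of_iterate (h a ha b hb a ha) (h a ha b hb b hb) (n + 2) fun f => ?_)
  rw [Function.iterate_succ_apply', Function.iterate_succ_apply']
  exact commutatorElement_eq_one_iff_commute.mpr
    (h a ha _ (hQ.iterate_commutator_mem ha f) a ha)

theorem Units.mem_center_of_commute {A : Subgroup Dˣ} (hn : ∀ h, ∀ g ∈ A, h * g * h⁻¹ ∈ A)
    (hc : ∀ a ∈ A, ∀ b ∈ A, Commute a b) : A ≤ center Dˣ := by
  intro a ha
  rw [mem_center_iff]
  intro v
  have hw : ∀ v : Dˣ, Commute a ⁅a, v⁆ := fun v => hc a ha _ (by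
    rw [commutatorElement_def, mul_assoc, mul_assoc, ← mul_assoc v]
    exact A.mul_mem ha (hn v _ (A.inv_mem ha)))
  by_contra hav
  have h0 : (1 : D) + v ≠ 0 := by
    intro h
    have hv : v = -1 := Units.ext (by simpa using (eq_neg_of_add_eq_zero_right h))
    exact hav (by simp [hv])
  set u := Units.mk0 _ h0 with hu
  have hcomm : ∀ v : Dˣ, (a : D) * v = (⁅a, v⁆ : Dˣ) * v * a := fun v => by
    rw [← Units.val_mul, ← Units.val_mul, ← Units.val_mul]
    simp [commutatorElement_def]
  have e1 := hcomm v
  have e2 := hcomm u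
  have c1 := (hw v).units_val.eq
  have c2 := (hw u).units_val.eq
  have hw1 : ((⁅a, v⁆ : Dˣ) : D) ≠ 1 := fun h => hav
    (commutatorElement_eq_one_iff_mul_comm.mp (Units.ext h)).symm
  generalize (⁅a, v⁆ : Dˣ).val = w at *
  generalize (⁅a, u⁆ : Dˣ).val = w' at *
  rw [hu, Units.val_mk0] at e2
  have f1 : 1 + w * v = w' * (1 + v) := by
    apply mul_right_cancel₀ a.ne_zero
    rw [← e2, mul_add, add_mul, e1, one_mul, mul_one]
  have f2 : 1 + w * (w * v) = w' * (1 + w * v) := by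
    apply mul_right_cancel₀ a.ne_zero
    calc (1 + w * (w * v)) * a = a * (1 + w * v) := by
          rw [mul_add, add_mul, ← mul_assoc (a : D) w, c1, mul_assoc w (a : D), e1]
          simp only [one_mul, mul_one, mul_assoc]
      _ = w' * (1 + w * v) * a := by
          rw [f1, ← mul_assoc (a : D), c2, mul_assoc w' (a : D), e2]
          simp only [mul_assoc]
  have f3 : w * ((w - 1) * v) = w' * ((w - 1) * v) := by
    have : w * ((w - 1) * v) = (1 + w * (w * v)) - (1 + w * v) := by noncomm_ring
    rw [this, f2]
    nth_rewrite 2 [f1]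
    noncomm_ring
  have f4 : w = w' := mul_right_cancel₀ (mul_ne_zero (sub_ne_zero.mpr hw1) v.ne_zero) f3
  rw [← f4, mul_add, mul_one] at f1
  exact hw1 (add_right_cancel f1).symm

theorem Subgroup.IsSubnormalOfDepth.le_center_of_commute {n : ℕ} : ∀ {A : Subgroup Dˣ},
    IsSubnormalOfDepth n A → (∀ a ∈ A, ∀ b ∈ A, Commute a b) → A ≤ center Dˣ := by
  induction n with
  | zero =>
    intro A hA hc a _
    rw [show A = ⊤ from hA] at hc
    exact mem_center_iff.mpr fun b => hc b trivial a trivial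
  | succ n ih =>
    rintro A hA hc
    obtain ⟨H, hH, hAH, hn⟩ := id hA
    cases n with
    | zero =>
      rw [show H = ⊤ from hH] at hn
      exact Units.mem_center_of_commute (fun h => hn h trivial) hc
    | succ n =>
      obtain ⟨M, hM, hHM, hnM⟩ := hH
      let S : Set Dˣ := {x | ∃ m ∈ M, ∃ a ∈ A, x = m * a * m⁻¹}
      have hpair : ∀ m ∈ M, ∀ a ∈ A, ∀ b ∈ A, Commute a (m * b * m⁻¹) := by
        intro m hm a ha b hb
        have hH' : m * b * m⁻¹ ∈ H := hnM m hm b (hAH hb)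
        set c := m * b * m⁻¹ with hcd
        have hc1 : ⁅a, c⁆ ∈ A := by
          rw [commutatorElement_def, mul_assoc, mul_assoc, ← mul_assoc c]
          exact A.mul_mem ha (hn c hH' _ (A.inv_mem ha))
        have hc2 : m⁻¹ * ⁅a, c⁆ * m ∈ A := by
          have ha' : m⁻¹ * a * m ∈ H := by
            simpa using hnM m⁻¹ (M.inv_mem hm) a (hAH ha)
          have : m⁻¹ * ⁅a, c⁆ * m = (m⁻¹ * a * m) * b * (m⁻¹ * a * m)⁻¹ * b⁻¹ := by
            rw [hcd, commutatorElement_def]; group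
          rw [this]
          exact A.mul_mem (hn _ ha' b hb) (A.inv_mem hb)
        refine commutatorElement_eq_one_iff_commute.mp (commutatorElement_eq_one_of_iterate
          (hc a ha _ hc1) ?_ (n + 1 + 1 + 1) fun f => ?_)
        · have h1 := (hc b hb _ hc2).eq
          change c * ⁅a, c⁆ = ⁅a, c⁆ * c
          have h2 : ⁅a, c⁆ = m * (m⁻¹ * ⁅a, c⁆ * m) * m⁻¹ := by group
          rw [h2, hcd]
          generalize m⁻¹ * ⁅a, m * b * m⁻¹⁆ * m = z at *
          calc _ = m * (b * z) * m⁻¹ := by group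
            _ = _ := by rw [h1]; group
        · rw [Function.iterate_succ_apply']
          exact commutatorElement_eq_one_iff_commute.mpr
            (hc a ha _ (hA.iterate_commutator_mem ha f))
      have hS : ∀ x ∈ S, ∀ y ∈ S, x * y = y * x := by
        rintro _ ⟨m, hm, a, ha, rfl⟩ _ ⟨k, hk, b, hb, rfl⟩
        have h1 := (hpair (m⁻¹ * k) (M.mul_mem (M.inv_mem hm) hk) a ha b hb).eq
        calc _ = m * (a * (m⁻¹ * k * b * (m⁻¹ * k)⁻¹)) * m⁻¹ := by group
          _ = _ := by rw [h1]; group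
      have hAS : A ≤ closure S := fun a ha => subset_closure ⟨1, M.one_mem, a, ha, by simp⟩
      refine hAS.trans (ih ⟨M, hM, ?_, ?_⟩ ?_)
      · rw [closure_le]
        rintro _ ⟨m, hm, a, ha, rfl⟩
        exact hHM (hnM m hm a (hAH ha))
      · intro k hk g hg
        induction hg using closure_induction with
        | mem x hx =>
          obtain ⟨m, hm, a, ha, rfl⟩ := hx
          exact subset_closure ⟨k * m, M.mul_mem hk hm, a, ha, by group⟩
        | one => simp
        | mul x y _ _ hx hy =>
          have : k * (x * y) * k⁻¹ = (k * x * k⁻¹) * (k * y * k⁻¹) := by group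
          rw [this]
          exact mul_mem hx hy
        | inv x _ hx =>
          have : k * x⁻¹ * k⁻¹ = (k * x * k⁻¹)⁻¹ := by group
          rw [this]
          exact inv_mem hx
      · have := isMulCommutative_closure hS
        exact fun a ha b hb => setLike_mul_comm ha hb

theorem Subgroup.IsSubnormalOfDepth.le_center {n : ℕ} {Q : Subgroup Dˣ}
    (hQ : IsSubnormalOfDepth n Q)
    (h : ∀ a ∈ Q, ∀ b ∈ Q, ∀ c ∈ Q, Commute c ⁅a, b⁆) : Q ≤ center Dˣ :=
  hQ.le_center_of_commute (hQ.commute_of_commute_commutatorElement h)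

end DivisionRing

section Fractions

open Polynomial

variable {R E D : Type*} [DivisionRing D]

/-- Polynomials over a division ring satisfy the right Ore condition modulo the kernel of any
homomorphism to a division ring. -/
theorem Polynomial.exists_map_mul_eq_map_mul [DivisionRing E] (ev : E[X] →+* D) :
    ∀ (n : ℕ) (p q : E[X]), q.natDegree = n → ev q ≠ 0 →
      ∃ s t, ev s ≠ 0 ∧ ev (p * s) = ev (q * t) := by
  intro n
  induction n using Nat.strong_induction_on with
  | _ n ih =>
    intro p q hn hq
    have hq0 : q ≠ 0 := by rintro rfl; exact hq (map_zero ev)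
    set c : E[X] := C q.leadingCoeff⁻¹ with hc
    have hm : (q * c).Monic := monic_mul_leadingCoeff_inv hq0
    set r := p %ₘ (q * c) with hr
    have hp : r + q * c * (p /ₘ (q * c)) = p := modByMonic_add_div _ _
    by_cases hr0 : ev r = 0
    · refine ⟨1, c * (p /ₘ (q * c)), by simp, ?_⟩
      rw [mul_one]
      nth_rewrite 1 [← hp]
      rw [map_add, hr0, zero_add, mul_assoc]
    · have hr1 : r ≠ 0 := by intro h; exact hr0 (by rw [h, map_zero])
      have hlt : r.natDegree < n := by
        have h1 : r.degree < (q * c).degree := degree_modByMonic_lt _ hm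
        rw [hc, degree_mul_leadingCoeff_inv _ hq0] at h1
        rw [← hn]
        exact natDegree_lt_natDegree hr1 h1
      obtain ⟨s, t, hs, hst⟩ := ih _ hlt q r rfl hr0
      refine ⟨t, c * (p /ₘ (q * c)) * t + s, ?_, ?_⟩
      · intro ht
        rw [map_mul, map_mul, ht, mul_zero] at hst
        exact (mul_ne_zero hq hs) hst
      · nth_rewrite 1 [← hp]
        rw [add_mul, mul_add, map_add, map_add, ← hst, add_comm]
        simp only [mul_assoc]

/-- `g` is a right fraction of elements of the range of `ev`. -/
def IsRightFraction [Ring R] (ev : R →+* D) (g : D) : Prop :=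
  ∃ p u, ev u ≠ 0 ∧ g * ev u = ev p

theorem isRightFraction_map [Ring R] (ev : R →+* D) (p : R) : IsRightFraction ev (ev p) :=
  ⟨p, 1, by simp, by simp⟩

theorem IsRightFraction.inv [Ring R] {ev : R →+* D} {g : D} (hg : IsRightFraction ev g) :
    IsRightFraction ev g⁻¹ := by
  rcases eq_or_ne g 0 with rfl | h0
  · rwa [inv_zero]
  · obtain ⟨p, u, hu, h⟩ := hg
    exact ⟨u, p, by rw [← h]; exact mul_ne_zero h0 hu, by rw [← h, inv_mul_cancel_left₀ h0]⟩

theorem IsRightFraction.mul [DivisionRing E] {ev : E[X] →+* D} {g h : D}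
    (hg : IsRightFraction ev g) (hh : IsRightFraction ev h) : IsRightFraction ev (g * h) := by
  obtain ⟨p, u, hu, hp⟩ := hg
  obtain ⟨q, v, hv, hq⟩ := hh
  obtain ⟨s, t, hs, hst⟩ := exists_map_mul_eq_map_mul ev _ q u rfl hu
  refine ⟨p * t, v * s, by rw [map_mul]; exact mul_ne_zero hv hs, ?_⟩
  rw [map_mul, mul_assoc, ← mul_assoc h, hq, ← map_mul, hst, map_mul, ← mul_assoc, hp, map_mul]

end Fractions

section Coefficients

variable {D : Type*} [DivisionRing D] {K : Subfield D} {s : Set D}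

/-- Multiply all coefficients on the right by `k`. -/
noncomputable def Finsupp.mulRightCoeff (k : K) : (s →₀ K) →ₗ[K] (s →₀ K) :=
  Finsupp.mapRange.linearMap (LinearMap.toSpanSingleton K K k)

theorem Finsupp.mulRightCoeff_apply (k : K) (f : s →₀ K) (i : s) :
    Finsupp.mulRightCoeff k f i = f i * k := by
  simp [Finsupp.mulRightCoeff]

theorem linearCombination_mulRightCoeff (hs : ∀ e ∈ s, ∀ k ∈ K, Commute e k) (k : K) (f : s →₀ K) :
    Finsupp.linearCombination K (Subtype.val : s → D) (Finsupp.mulRightCoeff k f) =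
      Finsupp.linearCombination K Subtype.val f * k := by
  induction f using Finsupp.induction_linear with
  | zero => simp
  | add f g hf hg => rw [map_add, map_add, map_add, hf, hg, add_mul]
  | single i c =>
    have h : Finsupp.mulRightCoeff k (Finsupp.single i c) = Finsupp.single i (c * k) := by
      rw [Finsupp.mulRightCoeff, Finsupp.mapRange.linearMap_apply, Finsupp.mapRange_single]
      rfl
    rw [h, Finsupp.linearCombination_single, Finsupp.linearCombination_single, Subfield.smul_def,
      Subfield.smul_def, smul_eq_mul, smul_eq_mul, mul_assoc, (hs i i.2 k k.2).eq]
    push_cast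
    rw [mul_assoc]

theorem linearCombination_mem_centralizer_centralizer (f : s →₀ K)
    (hf : ∀ i, (f i : D) ∈ Subring.center D) :
    Finsupp.linearCombination K (Subtype.val : s → D) f ∈
      Subfield.centralizer (Subfield.centralizer s : Set D) := by
  rw [Finsupp.linearCombination_apply]
  refine sum_mem fun i _ => mul_mem (fun k _ => Subring.mem_center_iff.mp (hf i) k) fun k hk => ?_
  exact (hk i i.2).symm

/-- If every element of `K` commuting with `J ⊆ K` is central, then a fraction `g` of
`K`-combinations of a set `s` commuting with `K` which conjugates `J` into `K` lies in `K` up to a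
factor from the double centralizer of `s`. -/
theorem exists_mul_inv_mem_centralizer_centralizer (hs : ∀ e ∈ s, ∀ k ∈ K, Commute e k)
    (hli : LinearIndependent K (Subtype.val : s → D)) {J : Set D} (hJK : J ⊆ K)
    (hJ : ∀ k ∈ K, (∀ j ∈ J, j * k = k * j) → k ∈ Subring.center D)
    {g p u : D} (hg : g ≠ 0) (hu0 : u ≠ 0) (hu : u ∈ Submodule.span K s)
    (hp : p ∈ Submodule.span K s) (hgu : g * u = p) (hgJ : ∀ j ∈ J, g⁻¹ * j * g ∈ K) :
    ∃ r ∈ K, r ≠ 0 ∧ g * r⁻¹ ∈ Subfield.centralizer (Subfield.centralizer s : Set D) := by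
  classical
  set L := Finsupp.linearCombination K (Subtype.val : s → D) with hL
  let P : ℕ → Prop := fun n => ∃ f f' : s →₀ K, L f ≠ 0 ∧ g * L f = L f' ∧ f.support.card = n
  have hP : ∃ n, P n := by
    obtain ⟨f, rfl⟩ := (Finsupp.mem_span_iff_linearCombination _ _ _).mp hu
    obtain ⟨f', rfl⟩ := (Finsupp.mem_span_iff_linearCombination _ _ _).mp hp
    exact ⟨_, f, f', hu0, hgu, rfl⟩
  obtain ⟨f₀, f₀', h0, h0', hcard⟩ := Nat.find_spec hP
  have hmin : ∀ f f' : s →₀ K, f.support.card < f₀.support.card → g * L f = L f' → L f = 0 := by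
    intro f f' hlt h
    by_contra hne
    exact Nat.find_min hP (hcard ▸ hlt) ⟨f, f', hne, h, rfl⟩
  have hf₀ : f₀ ≠ 0 := by rintro rfl; exact h0 (map_zero L)
  obtain ⟨i₀, hi₀⟩ := Finsupp.support_nonempty_iff.mpr hf₀
  have hc0 : f₀ i₀ ≠ 0 := Finsupp.mem_support_iff.mp hi₀
  set f := Finsupp.mulRightCoeff (f₀ i₀)⁻¹ f₀ with hf
  set f' := Finsupp.mulRightCoeff (f₀ i₀)⁻¹ f₀' with hf'
  have hLf : L f = L f₀ * ((f₀ i₀)⁻¹ : K) := linearCombination_mulRightCoeff hs _ _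
  have hLf' : L f' = L f₀' * ((f₀ i₀)⁻¹ : K) := linearCombination_mulRightCoeff hs _ _
  have hcK : (((f₀ i₀)⁻¹ : K) : D) ≠ 0 := by simpa using hc0
  have hLf0 : L f ≠ 0 := by rw [hLf]; exact mul_ne_zero h0 hcK
  have hgf : g * L f = L f' := by rw [hLf, hLf', ← mul_assoc, h0']
  have hf1 : f i₀ = 1 := by rw [hf, Finsupp.mulRightCoeff_apply, mul_inv_cancel₀ hc0]
  have hrel : ∀ j (hj : j ∈ J), (∀ i, g⁻¹ * j * g * f i = f i * (g⁻¹ * j * g)) ∧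
      ∀ i, j * f' i = f' i * (g⁻¹ * j * g) := by
    intro j hj
    set ψ : K := ⟨g⁻¹ * j * g, hgJ j hj⟩ with hψ
    have hgψ : g * (ψ : D) = j * g := by simp [hψ, mul_assoc, mul_inv_cancel_left₀ hg]
    let v := ψ • f - Finsupp.mulRightCoeff ψ f
    let v' := (⟨j, hJK hj⟩ : K) • f' - Finsupp.mulRightCoeff ψ f'
    have hvv : g * L v = L v' := by
      simp only [v, v', map_sub, map_smul, hL, linearCombination_mulRightCoeff hs]
      rw [← hL, Subfield.smul_def, Subfield.smul_def, smul_eq_mul, smul_eq_mul, mul_sub,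
        ← mul_assoc, hgψ, mul_assoc, hgf, ← mul_assoc, hgf]
    have hsub : v.support ⊂ f₀.support := by
      refine Finset.ssubset_iff_of_subset ?_ |>.mpr ⟨i₀, hi₀, ?_⟩
      · intro i hi
        rw [Finsupp.mem_support_iff] at hi ⊢
        intro h
        apply hi
        simp [v, hf, Finsupp.mulRightCoeff_apply, h]
      · simp [v, Finsupp.mulRightCoeff_apply, hf1]
    have hLv := hmin v v' (Finset.card_lt_card hsub) hvv
    have hv0 := linearIndependent_iff.mp hli v hLv
    have hv0' := linearIndependent_iff.mp hli v' (by rw [← hL, ← hvv, hLv, mul_zero])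
    constructor
    · intro i
      have := DFunLike.congr_fun hv0 i
      simp only [v, Finsupp.sub_apply, Finsupp.smul_apply, Finsupp.mulRightCoeff_apply,
        Finsupp.zero_apply, sub_eq_zero, smul_eq_mul] at this
      exact congrArg Subtype.val this
    · intro i
      have := DFunLike.congr_fun hv0' i
      simp only [v', Finsupp.sub_apply, Finsupp.smul_apply, Finsupp.mulRightCoeff_apply,
        Finsupp.zero_apply, sub_eq_zero, smul_eq_mul] at this
      exact congrArg Subtype.val this
  have hf'0 : f' ≠ 0 := by
    intro h
    rw [h, map_zero] at hgf
    exact mul_ne_zero hg hLf0 hgf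
  obtain ⟨i₁, hi₁⟩ := Finsupp.ne_iff.mp hf'0
  rw [Finsupp.zero_apply] at hi₁
  set r := f' i₁ with hr
  have hr0 : (r : D) ≠ 0 := by simpa using hi₁
  have hrψ : ∀ j ∈ J, (r : D)⁻¹ * j = g⁻¹ * j * g * (r : D)⁻¹ := by
    intro j hj
    rw [eq_mul_inv_iff_mul_eq₀ hr0, mul_assoc, (hrel j hj).2 i₁, ← hr, inv_mul_cancel_left₀ hr0]
  have hf'c : ∀ i, ((Finsupp.mulRightCoeff r⁻¹ f' i : K) : D) ∈ Subring.center D := by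
    intro i
    refine hJ _ (SetLike.coe_mem _) fun j hj => ?_
    rw [Finsupp.mulRightCoeff_apply]
    push_cast
    rw [← mul_assoc, (hrel j hj).2 i, mul_assoc, ← hrψ j hj, mul_assoc]
  have hfc : ∀ i, (f i : D) ∈ Subring.center D := by
    intro i
    have h1 : (r : D) * f i * (r : D)⁻¹ ∈ Subring.center D := by
      refine hJ _ (K.mul_mem (K.mul_mem r.2 (f i).2) (K.inv_mem r.2)) fun j hj => ?_
      rw [mul_assoc _ _ j, hrψ j hj, ← mul_assoc, ← mul_assoc, (hrel j hj).2 i₁, ← hr,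
        mul_assoc (r : D), (hrel j hj).1 i]
      simp only [mul_assoc]
    have h2 := Subring.mem_center_iff.mp h1 (r : D)
    have h3 : (f i : D) = r * f i * (r : D)⁻¹ := by
      apply mul_left_cancel₀ hr0
      rw [h2, inv_mul_cancel_right₀ hr0]
    rw [h3]
    exact h1
  refine ⟨r, r.2, hr0, ?_⟩
  set U := L f with hU
  set Z := L (Finsupp.mulRightCoeff r⁻¹ f') with hZ
  have hZr : g * U = Z * r := by
    have hZ' : Z = L f' * (r⁻¹ : K) := linearCombination_mulRightCoeff hs _ _
    rw [hgf, hZ', Subfield.coe_inv, inv_mul_cancel_right₀ hr0]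
  have hUE : U ∈ Subfield.centralizer (Subfield.centralizer s : Set D) :=
    linearCombination_mem_centralizer_centralizer f hfc
  have hUr : (r : D) * U = U * r := hUE r fun e he => (hs e he r r.2).eq
  have : g * (r : D)⁻¹ = Z * U⁻¹ := by
    rw [eq_mul_inv_iff_mul_eq₀ hLf0, mul_assoc,
      (show Commute (r : D) U from hUr).inv_left₀.eq, ← mul_assoc, hZr,
      mul_inv_cancel_right₀ hr0]
  rw [this]
  exact mul_mem (linearCombination_mem_centralizer_centralizer _ hf'c) (inv_mem hUE)

open Polynomial in
theorem IsRightFraction.exists_mul_inv_mem_centralizer_centralizer {x : D}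
    (hx : ∀ k : K, Commute (K.subtype k) x) {J : Set D} (hJK : J ⊆ K)
    (hJ : ∀ k ∈ K, (∀ j ∈ J, j * k = k * j) → k ∈ Subring.center D)
    {g : D} (hg0 : g ≠ 0) (hg : IsRightFraction (eval₂RingHom' K.subtype x hx) g)
    (hgJ : ∀ j ∈ J, g⁻¹ * j * g ∈ K) :
    ∃ r ∈ K, r ≠ 0 ∧ g * r⁻¹ ∈ Subfield.centralizer (Subfield.centralizer {x} : Set D) := by
  obtain ⟨s, hsub, hspan, hli⟩ := exists_linearIndependent K (Set.range fun n : ℕ => x ^ n)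
  obtain ⟨p, u, hu, h⟩ := hg
  have hmem : ∀ q, eval₂RingHom' K.subtype x hx q ∈ Submodule.span K s := by
    intro q
    rw [eval₂RingHom'_apply, eval₂_eq_sum, Polynomial.sum, hspan]
    exact Submodule.sum_mem _ fun n _ => Submodule.smul_mem _ (q.coeff n)
      (Submodule.subset_span ⟨n, rfl⟩)
  have hs : ∀ e ∈ s, ∀ k : D, Commute k x → Commute e k := by
    intro e he k hk
    obtain ⟨n, rfl⟩ := hsub he
    exact hk.symm.pow_left n
  obtain ⟨r, hr, hr0, hgr⟩ := _root_.exists_mul_inv_mem_centralizer_centralizer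
    (fun e he k hk => hs e he k (hx ⟨k, hk⟩)) hli hJK hJ hg0 hu (hmem u) (hmem p) h hgJ
  exact ⟨r, hr, hr0, fun k hk => hgr k fun e he => hs e he k (hk x rfl).symm⟩

end Coefficients

section Units

variable {D : Type*} [DivisionRing D]

theorem Units.mem_center_iff_val_mem_center {u : Dˣ} :
    u ∈ center Dˣ ↔ (u : D) ∈ Subring.center D := by
  rw [Subgroup.mem_center_iff, Subring.mem_center_iff]
  constructor
  · intro h d
    rcases eq_or_ne d 0 with rfl | hd
    · simp
    · exact congrArg Units.val (h (Units.mk0 d hd))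
  · exact fun h v => Units.ext (h v)

theorem Units.mem_center_of_commutatorElement_mem_center {t : Dˣ}
    (h : ∀ g : Dˣ, ⁅g, t⁆ ∈ center Dˣ) : t ∈ center Dˣ := by
  have hcomm : ∀ g : Dˣ, (g : D) * t = (⁅g, t⁆ : Dˣ) * t * g := fun g => by
    rw [← Units.val_mul, ← Units.val_mul, ← Units.val_mul]
    simp [commutatorElement_def]
  have hc := fun g => Subring.mem_center_iff.mp (Units.mem_center_iff_val_mem_center.mp (h g))
  rw [Subgroup.mem_center_iff]
  intro g
  by_contra hgt
  have h0 : (1 : D) + g ≠ 0 := by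
    intro h
    have hv : g = -1 := Units.ext (by simpa using (eq_neg_of_add_eq_zero_right h))
    exact hgt (by simp [hv])
  have e1 := hcomm g
  have e2 := hcomm (Units.mk0 _ h0)
  have c1 := hc g
  have c2 := hc (Units.mk0 _ h0)
  have hz : ((⁅g, t⁆ : Dˣ) : D) ≠ 1 := fun h =>
    hgt (commutatorElement_eq_one_iff_mul_comm.mp (Units.ext h))
  rw [Units.val_mk0] at e2
  generalize (⁅g, t⁆ : Dˣ).val = z at *
  generalize (⁅Units.mk0 _ h0, t⁆ : Dˣ).val = z' at *
  have f1 : 1 + z * g = z' * (1 + g) := by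
    apply mul_left_cancel₀ t.ne_zero
    calc t * (1 + z * g) = (1 + g) * t := by
          rw [mul_add, ← mul_assoc (t : D), c1, add_mul, e1, one_mul, mul_one]
      _ = _ := by rw [e2, ← c2, mul_assoc]
  have f2 : 1 - z' = (z' - z) * g := by
    have : 1 - z' = (1 + z * g) - z' - z * g := by abel
    rw [this, f1]
    noncomm_ring
  by_cases hzz : z' - z = 0
  · rw [hzz, zero_mul, sub_eq_zero] at f2
    exact hz (by rw [f2, sub_eq_zero.mp hzz])
  · have hZ : z' - z ∈ Subring.center D :=
      sub_mem (Subring.mem_center_iff.mpr c2) (Subring.mem_center_iff.mpr c1)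
    have hZ1 : 1 - z' ∈ Subring.center D := sub_mem (one_mem _) (Subring.mem_center_iff.mpr c2)
    rw [f2] at hZ1
    apply hgt
    refine Units.ext (mul_left_cancel₀ hzz ?_)
    change (z' - z) * (g * t) = (z' - z) * (t * g)
    rw [← mul_assoc, ← Subring.mem_center_iff.mp hZ1, ← mul_assoc (z' - z),
      ← Subring.mem_center_iff.mp hZ t, mul_assoc]

end Units

section Group

variable {Γ : Type*} [Group Γ]

theorem commute_commutatorElement_of_mem_center {g h t : Γ} (hg : ⁅g, t⁆ ∈ center Γ)
    (hh : ⁅h, t⁆ ∈ center Γ) : Commute ⁅g, h⁆ t := by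
  have e : ∀ g : Γ, g * t = ⁅g, t⁆ * t * g := fun g => by simp [commutatorElement_def]
  have e1 := e g
  have e2 := e h
  have c1 := mem_center_iff.mp hg
  have c2 := mem_center_iff.mp hh
  generalize ⁅g, t⁆ = z at *
  generalize ⁅h, t⁆ = w at *
  have f1 : g * h * t = z * w * t * (g * h) := by
    calc g * h * t = g * w * t * h := by rw [mul_assoc, e2]; simp only [mul_assoc]
      _ = w * (g * t) * h := by rw [c2 g]; simp only [mul_assoc]
      _ = w * z * t * (g * h) := by rw [e1]; simp only [mul_assoc]
      _ = z * w * t * (g * h) := by rw [c1 w]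
  have f2 : h * g * t = z * w * t * (h * g) := by
    calc h * g * t = h * z * t * g := by rw [mul_assoc, e1]; simp only [mul_assoc]
      _ = z * (h * t) * g := by rw [c1 h]; simp only [mul_assoc]
      _ = z * w * t * (h * g) := by rw [e2]; simp only [mul_assoc]
  have h3 : g * h = ⁅g, h⁆ * (h * g) := by simp [commutatorElement_def]
  rw [h3] at f1
  generalize ⁅g, h⁆ = k at *
  have c3 : k * (z * w) = z * w * k := by rw [← mul_assoc, c1, mul_assoc, c2, mul_assoc]
  refine mul_left_cancel (a := z * w) (mul_right_cancel (b := h * g) ?_)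
  calc z * w * (k * t) * (h * g) = k * (z * w) * t * (h * g) := by rw [c3]; simp only [mul_assoc]
    _ = k * (h * g * t) := by rw [f2]; simp only [mul_assoc]
    _ = z * w * (t * k) * (h * g) := by rw [← mul_assoc, f1]; simp only [mul_assoc]

theorem le_center_of_inf_le_center {V H : Subgroup Γ} (hn : ∀ h ∈ H, ∀ v ∈ V, h * v * h⁻¹ ∈ V)
    (hcen : ∀ t, (∀ h ∈ H, ⁅h, t⁆ ∈ center Γ) → t ∈ center Γ) {n : ℕ} :
    ∀ {X : Subgroup Γ}, IsSubnormalOfDepth n X → H ≤ X → V ⊓ X ≤ center Γ → V ≤ center Γ := by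
  induction n with
  | zero =>
    intro X hX _ h
    rwa [show X = ⊤ from hX, inf_top_eq] at h
  | succ n ih =>
    rintro X ⟨Y, hY, hXY, hnY⟩ hHX h
    refine ih hY (hHX.trans hXY) fun v hv => hcen v fun k hk => h (mem_inf.mpr ⟨?_, ?_⟩)
    · exact mul_mem (hn k hk v (mem_inf.mp hv).1) (inv_mem (mem_inf.mp hv).1)
    · rw [commutatorElement_def, mul_assoc, mul_assoc, ← mul_assoc v]
      exact mul_mem (hHX hk) (hnY v (mem_inf.mp hv).2 _ (inv_mem (hHX hk)))

theorem conj_commutatorElement_mem {H A : Subgroup Γ} (hn : ∀ h ∈ H, ∀ a ∈ A, h * a * h⁻¹ ∈ A)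
    {h x : Γ} (hh : h ∈ H) (hx : ∃ a ∈ A, ∃ b ∈ A, x = ⁅a, b⁆) :
    ∃ a ∈ A, ∃ b ∈ A, h * x * h⁻¹ = ⁅a, b⁆ := by
  obtain ⟨a, ha, b, hb, rfl⟩ := hx
  exact ⟨_, hn h hh a ha, _, hn h hh b hb, by simp only [commutatorElement_def]; group⟩

theorem conj_mem_centralizer {H : Subgroup Γ} {S : Set Γ} (hS : ∀ h ∈ H, ∀ x ∈ S, h * x * h⁻¹ ∈ S)
    {h v : Γ} (hh : h ∈ H) (hv : v ∈ centralizer S) : h * v * h⁻¹ ∈ centralizer S := by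
  rw [mem_centralizer_iff] at hv ⊢
  intro x hx
  have h1 : h⁻¹ * x * h * v = v * (h⁻¹ * x * h) :=
    hv _ (by simpa using hS h⁻¹ (inv_mem hh) x hx)
  calc x * (h * v * h⁻¹) = h * (h⁻¹ * x * h * v) * h⁻¹ := by group
    _ = _ := by rw [h1]; group

end Group

section Main

open Polynomial

variable {D : Type*} [DivisionRing D]

theorem Units.val_mem_subfieldCentralizer {S : Set Dˣ} {u : Dˣ} :
    (u : D) ∈ Subfield.centralizer (Units.val '' S) ↔ u ∈ centralizer S := by
  rw [Subfield.mem_centralizer, Set.forall_mem_image, mem_centralizer_iff]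
  exact forall₂_congr fun s _ => by rw [← Units.val_mul, ← Units.val_mul, Units.val_inj]

theorem commutator_mem_of_mul_inv_mem {K E : Subfield D} (hE : ∀ x ∈ E, ∀ y ∈ E, x * y = y * x)
    (hKE : ∀ x ∈ E, ∀ y ∈ K, x * y = y * x) {X Y : D} (hX0 : X ≠ 0) (hY0 : Y ≠ 0)
    (hX : ∃ r ∈ K, r ≠ 0 ∧ X * r⁻¹ ∈ E) (hY : ∃ r ∈ K, r ≠ 0 ∧ Y * r⁻¹ ∈ E) :
    X * Y * (Y * X)⁻¹ ∈ K := by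
  obtain ⟨r, hr, hr0, hc⟩ := hX
  obtain ⟨q, hq, hq0, hd⟩ := hY
  obtain ⟨c, hcX⟩ : ∃ c, c = X * r⁻¹ := ⟨_, rfl⟩
  obtain ⟨d, hdY⟩ : ∃ d, d = Y * q⁻¹ := ⟨_, rfl⟩
  rw [← hcX] at hc
  rw [← hdY] at hd
  have hX' : X = c * r := by rw [hcX, inv_mul_cancel_right₀ hr0]
  have hY' : Y = d * q := by rw [hdY, inv_mul_cancel_right₀ hq0]
  have h1 : X * Y = c * d * (r * q) := by
    rw [hX', hY', mul_assoc, ← mul_assoc r, ← hKE d hd r hr]; simp only [mul_assoc]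
  have h2 : Y * X = c * d * (q * r) := by
    rw [hX', hY', mul_assoc, ← mul_assoc q, ← hKE c hc q hq, hE c hc d hd]; simp only [mul_assoc]
  have hρ : r * q * (q * r)⁻¹ ∈ K := mul_mem (mul_mem hr hq) (inv_mem (mul_mem hq hr))
  have h3 : X * Y = r * q * (q * r)⁻¹ * (Y * X) := by
    rw [h2, ← mul_assoc, ← hKE _ (mul_mem hc hd) _ hρ, mul_assoc, inv_mul_cancel_right₀
      (mul_ne_zero hq0 hr0), h1]
  rw [h3, mul_inv_cancel_right₀ (mul_ne_zero hY0 hX0)]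
  exact hρ

/-- Under the centralizer hypotheses on `K` and `J`, every fraction of polynomials in `x` over `K`
lies in `K` up to a factor from the double centralizer of `x`. -/
theorem IsRightFraction.exists_mul_inv_mem_of_isSubnormalOfDepth {x : D} {K : Subfield D}
    (hx : ∀ k : K, Commute (K.subtype k) x) {H A : Subgroup Dˣ} (hAH : A ≤ H)
    (hAK : ∀ a ∈ A, (a : D) ∈ K)
    (hJ : ∀ k ∈ K, (∀ a ∈ A, ∀ b ∈ A, (⁅a, b⁆ : Dˣ) * k = k * (⁅a, b⁆ : Dˣ)) →
      k ∈ Subring.center D) {n : ℕ} :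
    ∀ {X : Subgroup Dˣ}, IsSubnormalOfDepth n X → H ≤ X →
      (∀ g ∈ X, IsRightFraction (eval₂RingHom' K.subtype x hx) g → ∃ r ∈ K, r ≠ 0 ∧
        (g : D) * r⁻¹ ∈ Subfield.centralizer (Subfield.centralizer {x} : Set D)) →
      ∀ g : Dˣ, IsRightFraction (eval₂RingHom' K.subtype x hx) (g : D) → ∃ r ∈ K, r ≠ 0 ∧
        (g : D) * r⁻¹ ∈ Subfield.centralizer (Subfield.centralizer {x} : Set D) := by
  set E := Subfield.centralizer (Subfield.centralizer {x} : Set D) with hEdef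
  have hKx : ∀ k ∈ K, k ∈ Subfield.centralizer {x} := by
    rintro k hk _ rfl
    exact (hx ⟨k, hk⟩).symm.eq
  have hKE : ∀ c ∈ E, ∀ y ∈ K, c * y = y * c := fun c hc y hy => (hc y (hKx y hy)).symm
  have hE : ∀ c ∈ E, ∀ d ∈ E, c * d = d * c := by
    intro c hc d hd
    refine hd c ?_
    rintro _ rfl
    refine hc _ ?_
    rintro _ rfl
    rfl
  induction n with
  | zero =>
    intro X hX _ h g
    rw [show X = ⊤ from hX] at h
    exact h g trivial
  | succ n ih =>
    rintro X ⟨Y, hY, hXY, hnY⟩ hHX h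
    refine ih hY (hHX.trans hXY) fun g hg hfr => ?_
    let J : Set D := {j | ∃ a ∈ A, ∃ b ∈ A, j = (⁅a, b⁆ : Dˣ)}
    have hJK : J ⊆ K := by
      rintro _ ⟨a, ha, b, hb, rfl⟩
      exact hAK _ (by
        rw [commutatorElement_def]
        exact mul_mem (mul_mem (mul_mem ha hb) (inv_mem ha)) (inv_mem hb))
    refine hfr.exists_mul_inv_mem_centralizer_centralizer hx hJK
      (fun k hk hkJ => hJ k hk fun a ha b hb => hkJ _ ⟨a, ha, b, hb, rfl⟩) g.ne_zero ?_
    have hconj : ∀ a ∈ A, ∃ r ∈ K, r ≠ 0 ∧ ((g⁻¹ * a * g : Dˣ) : D) * r⁻¹ ∈ E := by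
      intro a ha
      refine h _ (by simpa using hnY g⁻¹ (inv_mem hg) a (hHX (hAH ha))) ?_
      have hfa : IsRightFraction (eval₂RingHom' K.subtype x hx) (a : D) := by
        have := isRightFraction_map (eval₂RingHom' K.subtype x hx) (C ⟨a, hAK a ha⟩)
        simpa using this
      simpa using (hfr.inv.mul hfa).mul hfr
    rintro _ ⟨a, ha, b, hb, rfl⟩
    have := commutator_mem_of_mul_inv_mem hE hKE (Units.ne_zero _) (Units.ne_zero _)
      (hconj a ha) (hconj b hb)
    rw [← Units.val_mul, ← Units.val_mul, ← Units.val_inv_eq_inv_val, ← Units.val_mul] at this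
    rw [← Units.val_inv_eq_inv_val, ← Units.val_mul, ← Units.val_mul]
    have e : g⁻¹ * ⁅a, b⁆ * g =
        g⁻¹ * a * g * (g⁻¹ * b * g) * (g⁻¹ * b * g * (g⁻¹ * a * g))⁻¹ := by
      rw [commutatorElement_def]
      group
    rwa [e]

end Main

section CentralCommutators

open Polynomial

variable {D : Type*} [DivisionRing D]

/-- Let `A ≤ H` be a subgroup with elements in a division subring `K` and normalized by `H`. If only
central elements of `K` commute with the commutators of `A`, and some `x ∉ K` commutes with `K`,
then `A` is commutative. -/
theorem Subgroup.IsSubnormalOfDepth.commute_of_inf_centralizer {n : ℕ} {H A : Subgroup Dˣ}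
    (hH : IsSubnormalOfDepth n H) (hAH : A ≤ H) (hHA : ∀ h ∈ H, ∀ a ∈ A, h * a * h⁻¹ ∈ A)
    {K : Subfield D} (hAK : ∀ a ∈ A, (a : D) ∈ K)
    (hJ : ∀ k ∈ K, (∀ a ∈ A, ∀ b ∈ A, (⁅a, b⁆ : Dˣ) * k = k * (⁅a, b⁆ : Dˣ)) →
      k ∈ Subring.center D)
    {x : D} (hx : ∀ k ∈ K, Commute k x) (hxK : x ∉ K) : ∀ a ∈ A, ∀ b ∈ A, Commute a b := by
  have hx' : ∀ k : K, Commute (K.subtype k) x := fun k => hx k k.2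
  have hKx : ∀ k ∈ K, k ∈ Subfield.centralizer {x} := by
    rintro k hk _ rfl
    exact (hx k hk).symm.eq
  have hgood : ∀ g ∈ H, IsRightFraction (eval₂RingHom' K.subtype x hx') (g : D) →
      ∃ r ∈ K, r ≠ 0 ∧ (g : D) * r⁻¹ ∈ Subfield.centralizer (Subfield.centralizer {x} : Set D) := by
    intro g hg hfr
    have hcA : ∀ a ∈ A, ∀ b ∈ A, ⁅a, b⁆ ∈ A := fun a ha b hb => by
      rw [commutatorElement_def]
      exact mul_mem (mul_mem (mul_mem ha hb) (inv_mem ha)) (inv_mem hb)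
    let J : Set D := {j | ∃ a ∈ A, ∃ b ∈ A, j = (⁅a, b⁆ : Dˣ)}
    refine hfr.exists_mul_inv_mem_centralizer_centralizer hx' (J := J) ?_
      (fun k hk hkJ => hJ k hk fun a ha b hb => hkJ _ ⟨a, ha, b, hb, rfl⟩) g.ne_zero ?_
    · rintro _ ⟨a, ha, b, hb, rfl⟩
      exact hAK _ (hcA a ha b hb)
    · rintro _ ⟨a, ha, b, hb, rfl⟩
      rw [← Units.val_inv_eq_inv_val, ← Units.val_mul, ← Units.val_mul]
      exact hAK _ (by simpa using hHA g⁻¹ (inv_mem hg) _ (hcA a ha b hb))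
  intro a ha b hb
  have hy := hAK a ha
  have hg0 : (a : D) + x ≠ 0 := by
    intro h
    apply hxK
    rw [eq_neg_of_add_eq_zero_right h]
    exact neg_mem hy
  obtain ⟨r, hr, hr0, hc⟩ := IsRightFraction.exists_mul_inv_mem_of_isSubnormalOfDepth hx' hAH hAK
    hJ hH le_rfl hgood (Units.mk0 _ hg0) (by
      have := isRightFraction_map (eval₂RingHom' K.subtype x hx') (C ⟨a, hy⟩ + X)
      simpa using this)
  rw [Units.val_mk0] at hc
  have hk := hAK b hb
  set k := r * b * r⁻¹ with hkd
  have hkK : k ∈ K := mul_mem (mul_mem hr hk) (inv_mem hr)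
  have h1 : (a + x) * b = k * (a + x) := by
    have h2 := (hc k (hKx k hkK))
    calc (a + x) * b = (a + x) * r⁻¹ * (r * b) := by
          rw [mul_assoc, inv_mul_cancel_left₀ hr0]
      _ = (a + x) * r⁻¹ * k * r := by rw [hkd, mul_assoc _ _ r, inv_mul_cancel_right₀ hr0]
      _ = k * (a + x) := by rw [← h2, mul_assoc, inv_mul_cancel_right₀ hr0]
  have h3 : (a : D) * b - k * a = (k - b) * x := by
    rw [add_mul, mul_add, ← (hx b hk).eq] at h1
    rw [sub_mul, sub_eq_sub_iff_add_eq_add, h1, add_comm]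
  have h4 : k - b = 0 := by
    by_contra hne
    apply hxK
    have h5 : x = (k - b)⁻¹ * ((a : D) * b - k * a) := by rw [h3, inv_mul_cancel_left₀ hne]
    rw [h5]
    exact mul_mem (inv_mem (sub_mem hkK hk)) (sub_mem (mul_mem hy hk) (mul_mem hkK hy))
  rw [h4, zero_mul, sub_eq_zero, sub_eq_zero.mp h4] at h3
  exact Units.ext h3

/-- A unit commuting with a noncentral subnormal subgroup modulo the center is central. -/
theorem Subgroup.IsSubnormalOfDepth.mem_center_of_commutatorElement_mem_center {n : ℕ} :
    ∀ {G : Subgroup Dˣ}, IsSubnormalOfDepth n G → ¬ G ≤ center Dˣ →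
      ∀ t : Dˣ, (∀ g ∈ G, ⁅g, t⁆ ∈ center Dˣ) → t ∈ center Dˣ := by
  induction n with
  | zero =>
    intro G hG _ t ht
    rw [show G = ⊤ from hG] at ht
    exact Units.mem_center_of_commutatorElement_mem_center fun g => ht g trivial
  | succ n ih =>
    intro G hG hnc t ht
    obtain ⟨H, hH, hGH, hn⟩ := id hG
    have hC := ih hH fun h => hnc (hGH.trans h)
    let B : Set Dˣ := {x | ∃ a ∈ G, ∃ b ∈ G, x = ⁅a, b⁆}
    have hBH : ∀ h ∈ H, ∀ x ∈ B, h * x * h⁻¹ ∈ B := fun h hh x hx =>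
      conj_commutatorElement_mem hn hh hx
    set V := centralizer B with hV
    have htV : t ∈ V := by
      rw [hV, mem_centralizer_iff]
      rintro _ ⟨a, ha, b, hb, rfl⟩
      exact commute_commutatorElement_of_mem_center (ht a ha) (ht b hb)
    have hVH : ∀ h ∈ H, ∀ v ∈ V, h * v * h⁻¹ ∈ V := fun h hh v hv => conj_mem_centralizer hBH hh hv
    obtain ⟨x, hxB, hxc⟩ : ∃ x ∈ B, x ∉ center Dˣ := by
      by_contra! hB
      refine hnc (hG.le_center fun a ha b hb c _ => ?_)
      exact mem_center_iff.mp (hB _ ⟨a, ha, b, hb, rfl⟩) c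
    set A := V ⊓ H with hA
    have hAn : ∀ h ∈ H, ∀ a ∈ A, h * a * h⁻¹ ∈ A := fun h hh a ha =>
      mem_inf.mpr ⟨hVH h hh a (mem_inf.mp ha).1,
        mul_mem (mul_mem hh (mem_inf.mp ha).2) (inv_mem hh)⟩
    have hAd : IsSubnormalOfDepth (n + 1) A := ⟨H, hH, inf_le_right, hAn⟩
    have hAV : A ≤ center Dˣ → V ≤ center Dˣ := le_center_of_inf_le_center hVH hC hH le_rfl
    by_cases hAc : A ≤ center Dˣ
    · exact hAV hAc htV
    exfalso
    let J : Set Dˣ := {x | ∃ a ∈ A, ∃ b ∈ A, x = ⁅a, b⁆}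
    set U := V ⊓ centralizer J with hU
    have hUH : ∀ h ∈ H, ∀ u ∈ U, h * u * h⁻¹ ∈ U := fun h hh u hu =>
      mem_inf.mpr ⟨hVH h hh u (mem_inf.mp hu).1,
        conj_mem_centralizer (S := J)
          (fun h hh x hx => conj_commutatorElement_mem hAn hh hx) hh
          (mem_inf.mp hu).2⟩
    have hQ : U ⊓ H ≤ center Dˣ := by
      have hQd : IsSubnormalOfDepth (n + 1) (U ⊓ H) := ⟨H, hH, inf_le_right, fun h hh u hu =>
        mem_inf.mpr ⟨hUH h hh u (mem_inf.mp hu).1,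
          mul_mem (mul_mem hh (mem_inf.mp hu).2) (inv_mem hh)⟩⟩
      have hQA : U ⊓ H ≤ A := inf_le_inf_right H inf_le_left
      refine hQd.le_center fun a ha b hb c hc => ?_
      exact (mem_centralizer_iff.mp (mem_inf.mp (mem_inf.mp hc).1).2 _
        ⟨a, hQA ha, b, hQA hb, rfl⟩).symm
    have hUc : U ≤ center Dˣ := le_center_of_inf_le_center hUH hC hH le_rfl hQ
    set K := Subfield.centralizer (Units.val '' B : Set D) with hK
    have hJ : ∀ k ∈ K, (∀ a ∈ A, ∀ b ∈ A, (⁅a, b⁆ : Dˣ) * k = k * (⁅a, b⁆ : Dˣ)) →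
        k ∈ Subring.center D := by
      intro k hk hkJ
      rcases eq_or_ne k 0 with rfl | hk0
      · exact zero_mem _
      · lift k to Dˣ using hk0.isUnit
        refine Units.mem_center_iff_val_mem_center.mp (hUc (mem_inf.mpr
          ⟨Units.val_mem_subfieldCentralizer.mp hk, ?_⟩))
        rw [mem_centralizer_iff]
        rintro _ ⟨a, ha, b, hb, rfl⟩
        exact Units.ext (hkJ a ha b hb)
    refine hAc (hAd.le_center_of_commute (hH.commute_of_inf_centralizer inf_le_right hAn
      (K := K) (fun a ha => Units.val_mem_subfieldCentralizer.mpr (mem_inf.mp ha).1) hJ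
      (x := x) (fun k hk => (hk x ⟨x, hxB, rfl⟩).symm) fun hxK => hxc ?_))
    refine Units.mem_center_iff_val_mem_center.mpr (hJ x hxK fun a ha b hb => ?_)
    rw [← Units.val_mul, ← Units.val_mul]
    have h1 := mem_centralizer_iff.mp (mem_inf.mp ha).1 x hxB
    have h2 := mem_centralizer_iff.mp (mem_inf.mp hb).1 x hxB
    have h3 : Commute x a := h1
    have h4 : Commute x b := h2
    rw [commutatorElement_def]
    exact congrArg Units.val
      (((h3.mul_right h4).mul_right h3.inv_right).mul_right h4.inv_right).symm.eq

end CentralCommutators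

theorem Subgroup.IsSubnormal'.exists_isSubnormalOfDepth {Γ : Type*} [Group Γ] {G : Subgroup Γ}
    (h : G.IsSubnormal') : ∃ n, IsSubnormalOfDepth n G := by
  obtain ⟨r, c, rfl, hr, hc⟩ := h
  have : ∀ i : Fin (r + 1), ∃ n, IsSubnormalOfDepth n (c i) := by
    intro i
    induction i using Fin.reverseInduction with
    | last => exact ⟨0, hr⟩
    | cast i ih =>
      obtain ⟨n, hn⟩ := ih
      exact ⟨n + 1, _, hn, (hc i).1, fun h hh g hg => (hc i).2 g hg h hh⟩
  exact this 0

theorem commutatorElement_inv_mem_center {Γ : Type*} [Group Γ] {τ : Γ → Γ}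
    (hτ : ∀ x y, τ (x * y) = τ y * τ x) {g h : Γ} (hg : g * τ g ∈ center Γ)
    (hgh : h * g * h⁻¹ * τ (h * g * h⁻¹) ∈ center Γ) : ⁅g, (τ h * h)⁻¹⁆ ∈ center Γ := by
  have h1 : τ 1 = 1 := by simpa using hτ 1 1
  have hinv : τ h⁻¹ = (τ h)⁻¹ := by
    rw [eq_inv_iff_mul_eq_one, ← hτ, mul_inv_cancel, h1]
  set c := g * τ g with hc
  have hgc : τ g = g⁻¹ * c := by rw [hc, inv_mul_cancel_left]
  rw [hτ, hτ, hinv, hgc] at hgh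
  rw [mul_assoc g⁻¹, ← mem_center_iff.mp hg (τ h), ← mul_assoc, ← mul_assoc, ← mul_assoc] at hgh
  have hy := mul_mem hgh (inv_mem hg)
  rw [mul_inv_cancel_right] at hy
  have e : ⁅g, (τ h * h)⁻¹⁆ = h⁻¹ * (h * g * h⁻¹ * ((τ h)⁻¹ * (g⁻¹ * τ h))) * h := by
    rw [commutatorElement_def]
    group
  rw [e, ← mul_assoc (τ h)⁻¹, mem_center_iff.mp (by simpa only [mul_assoc] using hy) h⁻¹,
    inv_mul_cancel_right]
  simpa only [mul_assoc] using hy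

/-- If `x * τ x` is central for all units `x` in a noncentral subnormal subgroup, then it is central
for all units. -/
theorem Subgroup.IsSubnormalOfDepth.mul_map_mem_center {D : Type*} [DivisionRing D] {τ : Dˣ → Dˣ}
    (hτ : ∀ x y, τ (x * y) = τ y * τ x) {n : ℕ} :
    ∀ {G : Subgroup Dˣ}, IsSubnormalOfDepth n G → ¬ G ≤ center Dˣ →
      (∀ g ∈ G, g * τ g ∈ center Dˣ) → ∀ g, g * τ g ∈ center Dˣ := by
  induction n with
  | zero =>
    intro G hG _ h g
    rw [show G = ⊤ from hG] at h
    exact h g trivial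
  | succ n ih =>
    intro G hG hnc h
    obtain ⟨H, hH, hGH, hn⟩ := id hG
    refine ih hH (fun hc => hnc (hGH.trans hc)) fun k hk => ?_
    have ht := hG.mem_center_of_commutatorElement_mem_center hnc (τ k * k)⁻¹ fun g hg =>
      commutatorElement_inv_mem_center hτ (h g hg) (h _ (hn k hk g hg))
    have ht' := mem_center_iff.mp (by simpa using inv_mem ht : τ k * k ∈ center Dˣ) k
    rw [← mul_assoc] at ht'
    rw [mul_right_cancel ht']
    simpa using inv_mem ht

/-- Let `D` be a division ring with center `F`, `G` a non-central
subnormal subgroup of `Dˣ`, and `σ` an involution of the first kind on `D`. Then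
`g * σ g ∈ F` for every `g ∈ G` iff `x * σ x ∈ F` for every `x ∈ D` (i.e. `σ` is
scalar). -/
theorem norms_central_on_subnormal_iff_scalar (D : Type*) [DivisionRing D]
    (σ : D → D)
    (hadd : ∀ x y : D, σ (x + y) = σ x + σ y)
    (hmul : ∀ x y : D, σ (x * y) = σ y * σ x)
    (hinvo : ∀ x : D, σ (σ x) = x)
    (hfirst : ∀ x ∈ Subring.center D, σ x = x)
    (G : Subgroup Dˣ) (hsub : G.IsSubnormal')
    (hnc : ¬ G ≤ Subgroup.center Dˣ) :
    (∀ g ∈ G, (g : D) * σ (g : D) ∈ Subring.center D) ↔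
      (∀ x : D, x * σ x ∈ Subring.center D) := by
  refine ⟨fun h x => ?_, fun h g _ => h g⟩
  obtain ⟨n, hG⟩ := hsub.exists_isSubnormalOfDepth
  have h1 : σ 1 = 1 := hfirst 1 (one_mem _)
  let τ : Dˣ → Dˣ := fun u => ⟨σ u, σ (u⁻¹ : Dˣ), by rw [← hmul, u.inv_mul, h1],
    by rw [← hmul, u.mul_inv, h1]⟩
  have hτ : ∀ x y, τ (x * y) = τ y * τ x := fun x y => Units.ext (hmul x y)
  rcases eq_or_ne x 0 with rfl | hx
  · rw [zero_mul]
    exact zero_mem _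
  · exact Units.mem_center_iff_val_mem_center.mp (hG.mul_map_mem_center hτ hnc
      (fun g hg => Units.mem_center_iff_val_mem_center.mpr (h g hg)) (Units.mk0 x hx))
end

section
/- Let D be a division ring with center F, let G be a subgroup of D^× such that the sub-division-ring of D generated by F ∪ G equals D (i.e., F(G) = D), and let ⋆ be an involution of the first kind on D. If g + g^⋆ ∈ F for every g ∈ G, then D is centrally finite, i.e., D is finite-dimensional over F. -/
/-- If `a + s`, `b + u` and `a * b + u * s` (a product and the product of the conjugates in reverse
order) commute with `a` and `a + s` commutes with `b`, then `a * s` commutes with `b`. -/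
theorem mul_conj_commute_of_traces_commute {R : Type*} [Ring R] {a b s u : R}
    (hw : a * (a * b + u * s) = (a * b + u * s) * a) (hr : a * (b + u) = (b + u) * a)
    (hta : a * (a + s) = (a + s) * a) (htb : b * (a + s) = (a + s) * b) :
    b * (a * s) = a * s * b := by
  have h : a * s * b - b * (a * s) =
      -(a * (a * b + u * s) - (a * b + u * s) * a) + (a * (b + u) - (b + u) * a) * s
        - a * (b * (a + s) - (a + s) * b) + u * (a * (a + s) - (a + s) * a) := by
    noncomm_ring
  rw [hw, hr, hta, htb] at h
  simp only [sub_self, neg_zero, zero_mul, mul_zero, add_zero] at h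
  exact (sub_eq_zero.mp h).symm

/-- A division ring with an involution that is linear over the center and has central
traces is finite-dimensional over its center. -/
theorem finite_over_center_of_traces_central {D : Type*} [DivisionRing D] (σ : D → D)
    (hadd : ∀ x y : D, σ (x + y) = σ x + σ y)
    (hmul : ∀ x y : D, σ (x * y) = σ y * σ x)
    (hinvo : ∀ x : D, σ (σ x) = x)
    (hsmul : ∀ (c : Subring.center D) (x : D), σ (c • x) = c • σ x)
    (htr : ∀ x, x + σ x ∈ Subring.center D) :
    Module.Finite (Subring.center D) D := by
  by_cases hc : ∀ x y : D, x * y = y * x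
  · refine Module.Finite.of_surjective
      (LinearMap.toSpanSingleton (Subring.center D) D 1) fun x => ?_
    refine ⟨⟨x, Subring.mem_center_iff.mpr fun y => hc y x⟩, ?_⟩
    simp [Subring.smul_def]
  push Not at hc
  obtain ⟨a, b, hab⟩ := hc
  let T : D →ₗ[Subring.center D] Subring.center D :=
    { toFun := fun x => ⟨x + σ x, htr x⟩
      map_add' := fun x y => by
        ext
        simp only [hadd, Subring.coe_add]
        abel
      map_smul' := fun c x => by
        ext
        change c • x + σ (c • x) = c • (x + σ x)
        rw [hsmul, smul_add] }
  have hT : ∀ x, T x = 0 → σ x = -x := fun x h =>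
    (neg_eq_of_add_eq_zero_right (congrArg Subtype.val h)).symm
  let R (y : D) : D →ₗ[Subring.center D] D :=
    { toFun := fun x => x * y
      map_add' := fun x z => add_mul x z y
      map_smul' := fun c x => by simp [Subring.smul_def, mul_assoc] }
  let L : D →ₗ[Subring.center D] (Fin 4 → Subring.center D) :=
    LinearMap.pi ![T, T ∘ₗ R a, T ∘ₗ R b, T ∘ₗ R (a * b)]
  refine Module.Finite.of_injective L ((injective_iff_map_eq_zero L).mpr fun c hL => ?_)
  have hσ : σ c = -c := hT c (congrFun hL 0)
  have h₁ : σ (c * a) = -(c * a) := hT _ (congrFun hL 1)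
  have h₂ : σ (c * b) = -(c * b) := hT _ (congrFun hL 2)
  have h₃ : σ (c * (a * b)) = -(c * (a * b)) := hT _ (congrFun hL 3)
  rw [hmul, hσ, mul_neg, neg_inj] at h₁ h₂ h₃
  rw [hmul] at h₃
  have h : (σ a * σ b - σ b * σ a) * c = 0 := by
    rw [sub_mul, h₃, mul_assoc, h₂, ← mul_assoc, h₁, mul_assoc, sub_self]
  refine (mul_eq_zero.mp h).resolve_left fun h' => hab ?_
  rw [sub_eq_zero, ← hmul, ← hmul] at h'
  rw [← hinvo (a * b), ← h', hinvo]


/-- Let `D` be a division ring with center `F`, `G` a subgroup of `Dˣ`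
such that the sub-division-ring generated by `F ∪ G` is all of `D`, and `σ` an
involution of the first kind on `D`. If `g + σ g ∈ F` for every `g ∈ G`, then `D`
is finite-dimensional over `F`. -/
theorem centrally_finite_of_traces_central_on_generating_subgroup
    (D : Type*) [DivisionRing D]
    (σ : D → D)
    (hadd : ∀ x y : D, σ (x + y) = σ x + σ y)
    (hmul : ∀ x y : D, σ (x * y) = σ y * σ x)
    (hinvo : ∀ x : D, σ (σ x) = x)
    (hfirst : ∀ x ∈ Subring.center D, σ x = x)
    (G : Subgroup Dˣ)
    (hgen : Subfield.closure ((Subring.center D : Set D) ∪ (Units.val '' (G : Set Dˣ))) = ⊤)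
    (htr : ∀ g ∈ G, (g : D) + σ (g : D) ∈ Subring.center D) :
    Module.Finite (Subring.center D) D := by
  have hcomm : ∀ c ∈ Subring.center D, ∀ x : D, x * c = c * x := fun c hc x =>
    Subring.mem_center_iff.mp hc x
  have hsmul : ∀ (c : Subring.center D) (x : D), σ (c • x) = c • σ x := fun c x => by
    rw [Subring.smul_def, Subring.smul_def, smul_eq_mul, smul_eq_mul, hmul, hfirst c c.2,
      hcomm c c.2]
  let A : Submodule (Subring.center D) D :=
    Submodule.span (Subring.center D) (Units.val '' (G : Set Dˣ))
  have hG : ∀ g ∈ G, (g : D) ∈ A := fun g hg => Submodule.subset_span ⟨g, hg, rfl⟩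
  have hone : (1 : D) ∈ A := hG 1 G.one_mem
  have hF : ∀ c ∈ Subring.center D, c ∈ A := fun c hc => by
    simpa [Subring.smul_def] using A.smul_mem ⟨c, hc⟩ hone
  have hmulA : ∀ x ∈ A, ∀ y ∈ A, x * y ∈ A := by
    intro x hx y hy
    induction hx using Submodule.span_induction with
    | mem x hx =>
      obtain ⟨g, hg, rfl⟩ := hx
      induction hy using Submodule.span_induction with
      | mem y hy =>
        obtain ⟨k, hk, rfl⟩ := hy
        exact hG (g * k) (G.mul_mem hg hk)
      | zero => simp
      | add y z _ _ hy hz => simpa [mul_add] using A.add_mem hy hz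
      | smul c y _ hy =>
        have : (g : D) * (c • y) = c • ((g : D) * y) := by
          rw [Subring.smul_def, Subring.smul_def, smul_eq_mul, smul_eq_mul, ← mul_assoc,
            hcomm c c.2, mul_assoc]
        rw [this]
        exact A.smul_mem c hy
    | zero => simp
    | add x z _ _ hx hz => simpa [add_mul] using A.add_mem hx hz
    | smul c x _ hx => simpa [Subring.smul_def, mul_assoc] using A.smul_mem c hx
  have hT : ∀ x ∈ A, x + σ x ∈ Subring.center D := by
    intro x hx
    induction hx using Submodule.span_induction with
    | mem x hx =>
      obtain ⟨g, hg, rfl⟩ := hx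
      exact htr g hg
    | zero =>
      have h : σ 0 = 0 := hfirst 0 (Subring.zero_mem _)
      simp [h]
    | add x y _ _ hx hy =>
      rw [hadd, add_add_add_comm]
      exact Subring.add_mem _ hx hy
    | smul c x _ hx =>
      rw [hsmul, ← smul_add]
      exact Subring.mul_mem _ c.2 hx
  have hσA : ∀ x ∈ A, σ x ∈ A := fun x hx => by
    simpa using A.sub_mem (hF _ (hT x hx)) hx
  have hN : ∀ x ∈ A, x * σ x ∈ Subring.center D := by
    intro x hx
    have hA : ∀ y ∈ A, y * (x * σ x) = x * σ x * y := fun y hy => by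
      refine mul_conj_commute_of_traces_commute (u := σ y) ?_ (hcomm _ (hT y hy) _)
        (hcomm _ (hT x hx) _) (hcomm _ (hT x hx) _)
      rw [← hmul]
      exact hcomm _ (hT _ (hmulA x hx y hy)) _
    refine Subring.mem_center_iff.mpr fun z => ?_
    have hz : z ∈ Subfield.closure
        ((Subring.center D : Set D) ∪ (Units.val '' (G : Set Dˣ))) := hgen ▸ Subfield.mem_top z
    change Commute z (x * σ x)
    induction hz using Subfield.closure_induction with
    | mem z hz =>
      rcases hz with hz | ⟨g, hg, rfl⟩
      · exact hA z (hF z hz)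
      · exact hA g (hG g hg)
    | one => exact Commute.one_left _
    | add _ _ _ _ h₁ h₂ => exact h₁.add_left h₂
    | neg _ _ h => exact h.neg_left
    | inv _ _ h => exact h.inv_left₀
    | mul _ _ _ _ h₁ h₂ => exact h₁.mul_left h₂
  have hinv : ∀ x ∈ A, x⁻¹ ∈ A := by
    intro x hx
    rcases eq_or_ne x 0 with rfl | hx0
    · simp
    have hσ0 : σ x ≠ 0 := fun h => hx0 <| by
      rw [← hinvo x, h]
      exact hfirst 0 (Subring.zero_mem _)
    have h : x⁻¹ = σ x * (x * σ x)⁻¹ := by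
      rw [mul_inv_rev, ← mul_assoc, mul_inv_cancel₀ hσ0, one_mul]
    rw [h]
    exact hmulA _ (hσA x hx) _ (hF _ (Set.inv_mem_center (hN x hx)))
  have htop : ∀ z : D, z ∈ A := by
    intro z
    have hz : z ∈ Subfield.closure
        ((Subring.center D : Set D) ∪ (Units.val '' (G : Set Dˣ))) := hgen ▸ Subfield.mem_top z
    induction hz using Subfield.closure_induction with
    | mem z hz =>
      rcases hz with hz | ⟨g, hg, rfl⟩
      · exact hF z hz
      · exact hG g hg
    | one => exact hone
    | add _ _ _ _ h₁ h₂ => exact A.add_mem h₁ h₂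
    | neg _ _ h => exact A.neg_mem h
    | inv _ _ h => exact hinv _ h
    | mul _ _ _ _ h₁ h₂ => exact hmulA _ h₁ _ h₂
  exact finite_over_center_of_traces_central σ hadd hmul hinvo hsmul fun x => hT x (htop x)
end
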